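/- Let q be a prime power. The group algebra ℂ[SL₂(𝔽_q)] is of Knutson type (every irreducible complex character of SL₂(𝔽_q) is regular invertible) if and only if q is a power of 2 or q = 3. -/

import Mathlib

open scoped ComplexOrder

noncomputable section

/-- `χ : G → ℂ` is an irreducible character: the character of a simple
finite-dimensional complex representation of `G`. -/
def IsIrrChar (G : Type) [Group G] (χ : G → ℂ) : Prop :=
  ∃ V : FDRep ℂ G, CategoryTheory.Simple V ∧ χ = V.character

/-- A virtual character is a `ℤ`-linear combination of irreducible characters. -/
def IsVirtualChar (G : Type) [Group G] (χ : G → ℂ) : Prop :=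
  χ ∈ Submodule.span ℤ {f : G → ℂ | IsIrrChar G f}

open Classical in
/-- The regular character: `|G|` at the identity, `0` elsewhere. -/
def regChar (G : Type) [Group G] : G → ℂ :=
  fun g => if g = 1 then (Nat.card G : ℂ) else 0

/-- The Knutson index of `χ`: the least positive `n` such that `χ·φ = n·ρ_reg`
for some virtual character `φ`. -/
def KnutsonIndex (G : Type) [Group G] (χ : G → ℂ) : ℕ :=
  sInf {n : ℕ | 0 < n ∧ ∃ φ : G → ℂ, IsVirtualChar G φ ∧ χ * φ = n • regChar G}

/-- `ℂ[G]` is of Knutson type: every irreducible character is regular invertible. -/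
def IsKnutsonType (G : Type) [Group G] : Prop :=
  ∀ χ : G → ℂ, IsIrrChar G χ → ∃ φ : G → ℂ, IsVirtualChar G φ ∧ χ * φ = regChar G

/-- Savitskii's preorder: `φ ≤ χ` iff `φ(1) ≤ χ(1)` and every zero of `χ` is a zero of `φ`. -/
def SavitskiiLE (G : Type) [Group G] (φ χ : G → ℂ) : Prop :=
  φ 1 ≤ χ 1 ∧ ∀ g : G, χ g = 0 → φ g = 0

/-- A virtual character of positive degree is Savitskii-minimal if every virtual
character of positive degree below it is also above it. -/
def SavitskiiMinimal (G : Type) [Group G] (χ : G → ℂ) : Prop :=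
  ∀ φ : G → ℂ, IsVirtualChar G φ → 0 < φ 1 → SavitskiiLE G φ χ → SavitskiiLE G χ φ

end

/-- An irreducible representation has no invariant subspaces besides `⊥` and `⊤`. -/
theorem Representation.IsIrreducible.eq_bot_or_eq_top {G V : Type} [Group G] [AddCommGroup V]
    [Module ℂ V] {ρ : Representation ℂ G V} (h : ρ.IsIrreducible) (p : Submodule ℂ V)
    (hp : ∀ g, ∀ v ∈ p, ρ g v ∈ p) : p = ⊥ ∨ p = ⊤ := by
  rcases IsSimpleOrder.eq_bot_or_eq_top (⟨p, fun g v hv => hp g v hv⟩ : Subrepresentation ρ)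
    with h | h
  · left; exact congrArg Subrepresentation.toSubmodule h
  · right; exact congrArg Subrepresentation.toSubmodule h

/-- The orbit of a nonzero vector spans an irreducible representation. -/
theorem Representation.IsIrreducible.span_orbit {G V : Type} [Group G] [AddCommGroup V]
    [Module ℂ V] {ρ : Representation ℂ G V} (h : ρ.IsIrreducible) {v : V} (hv : v ≠ 0) :
    Submodule.span ℂ (Set.range fun g => ρ g v) = ⊤ := by
  refine (h.eq_bot_or_eq_top _ fun g w hw => ?_).resolve_left fun hb => ?_
  · have : Submodule.map (ρ g) (Submodule.span ℂ (Set.range fun g => ρ g v)) ≤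
        Submodule.span ℂ (Set.range fun g => ρ g v) := by
      rw [Submodule.map_span, Submodule.span_le]
      rintro _ ⟨_, ⟨k, rfl⟩, rfl⟩
      exact Submodule.subset_span ⟨g * k, by simp⟩
    exact this ⟨w, hw, rfl⟩
  · have : v ∈ Submodule.span ℂ (Set.range fun g => ρ g v) := Submodule.subset_span ⟨1, by simp⟩
    rw [hb] at this
    exact hv (by simpa using this)

theorem Representation.IsIrreducible.nontrivial {G V : Type} [Group G] [AddCommGroup V]
    [Module ℂ V] {ρ : Representation ℂ G V} (h : ρ.IsIrreducible) : Nontrivial V := by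
  by_contra hV
  rw [not_nontrivial_iff_subsingleton] at hV
  obtain ⟨a, b, hab⟩ := h.exists_pair_ne
  exact hab (SetLike.ext fun x => by
    rw [Subsingleton.elim x 0]
    exact iff_of_true a.toSubmodule.zero_mem b.toSubmodule.zero_mem)

theorem Representation.isIrreducible_of_finrank_intertwiningMap {G V : Type} [Group G] [Fintype G]
    [AddCommGroup V] [Module ℂ V] {ρ : Representation ℂ G V}
    (h : Module.finrank ℂ (IntertwiningMap ρ ρ) = 1) : ρ.IsIrreducible := by
  have hc : ComplementedLattice (Subrepresentation ρ) := inferInstance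
  have hV : Nontrivial V := by
    by_contra hV
    rw [not_nontrivial_iff_subsingleton] at hV
    have : Subsingleton (IntertwiningMap ρ ρ) :=
      ⟨fun a b => by ext v; exact Subsingleton.elim _ _⟩
    rw [Module.finrank_zero_of_subsingleton] at h
    exact zero_ne_one h
  have hne : (⊥ : Subrepresentation ρ) ≠ ⊤ := fun hb => by
    obtain ⟨v, hv⟩ := exists_ne (0 : V)
    have : (⊥ : Submodule ℂ V) = ⊤ := congrArg Subrepresentation.toSubmodule hb
    exact bot_ne_top this
  have : Nontrivial (Subrepresentation ρ) := ⟨⊥, ⊤, hne⟩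
  refine ⟨fun p => ?_⟩
  obtain ⟨q, hpq⟩ := exists_isCompl p
  have hpq' : IsCompl p.toSubmodule q.toSubmodule := by
    constructor
    · rw [disjoint_iff]
      exact congrArg Subrepresentation.toSubmodule hpq.inf_eq_bot
    · rw [codisjoint_iff]
      exact congrArg Subrepresentation.toSubmodule hpq.sup_eq_top
  set π : V →ₗ[ℂ] V := p.toSubmodule.projection q.toSubmodule hpq' with hπdef
  have h1 : ∀ x ∈ p.toSubmodule, π x = x := fun x hx =>
    Submodule.projection_apply_of_mem_left hpq' hx
  have h2 : ∀ x ∈ q.toSubmodule, π x = 0 := fun x hx =>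
    Submodule.projection_apply_of_mem_right hpq' hx
  have hπ : ∀ g v, π (ρ g v) = ρ g (π v) := by
    intro g v
    obtain ⟨a, ha, b, hb, rfl⟩ := Submodule.mem_sup.mp
      (show v ∈ p.toSubmodule ⊔ q.toSubmodule by rw [hpq'.sup_eq_top]; trivial)
    simp only [map_add]
    rw [h1 _ ha, h2 _ hb, h1 _ (p.apply_mem_toSubmodule g ha), h2 _ (q.apply_mem_toSubmodule g hb)]
    simp
  let P : IntertwiningMap ρ ρ := ⟨π, fun g => LinearMap.ext fun v => hπ g v⟩
  let I : IntertwiningMap ρ ρ := ⟨LinearMap.id, fun g => rfl⟩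
  have hI : I ≠ 0 := fun h0 => by
    obtain ⟨v, hv⟩ := exists_ne (0 : V)
    exact hv (congrArg (fun f : IntertwiningMap ρ ρ => f v) h0)
  obtain ⟨c, hc⟩ := (finrank_eq_one_iff_of_nonzero' I hI).mp h P
  have hc' : ∀ v, π v = c • v := fun v =>
    (congrArg (fun f : IntertwiningMap ρ ρ => f v) hc).symm
  by_cases hc0 : c = 0
  · left
    refine Subrepresentation.toSubmodule_injective ?_
    refine (Submodule.eq_bot_iff _).mpr fun x hx => ?_
    rw [← h1 x hx, hc', hc0, zero_smul]
  · right
    refine Subrepresentation.toSubmodule_injective ?_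
    refine (Submodule.eq_top_iff').mpr fun x => ?_
    have : x = π (c⁻¹ • x) := by rw [hc', smul_smul, mul_inv_cancel₀ hc0, one_smul]
    rw [this]
    exact Submodule.projection_apply_mem hpq' _

theorem isIrrChar_iff {G : Type} [Group G] [Fintype G] {χ : G → ℂ} :
    IsIrrChar G χ ↔ ∃ (V : Type) (_ : AddCommGroup V) (_ : Module ℂ V)
      (_ : FiniteDimensional ℂ V) (ρ : Representation ℂ G V),
      ρ.IsIrreducible ∧ χ = ρ.character := by
  have hG : (Nat.card G : ℂ) ≠ 0 := Nat.cast_ne_zero.mpr Nat.card_pos.ne'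
  have : Invertible (Nat.card G : ℂ) := invertibleOfNonzero hG
  constructor
  · rintro ⟨V, hV, rfl⟩
    refine ⟨V, inferInstance, inferInstance, inferInstance, V.ρ, ?_, rfl⟩
    apply Representation.isIrreducible_of_finrank_intertwiningMap
    have h := (FDRep.simple_iff_char_is_norm_one V).mp hV
    have h2 := Representation.card_inv_mul_sum_char_mul_char_eq_finrank V.ρ V.ρ
    rw [show ∑ g : G, Representation.character V.ρ g * Representation.character V.ρ g⁻¹ =
        ∑ g : G, V.character g * V.character g⁻¹ from rfl, h,
      inv_mul_cancel₀ hG] at h2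
    exact_mod_cast h2.symm
  · rintro ⟨V, _, _, _, ρ, hρ, rfl⟩
    refine ⟨FDRep.of ρ, ?_, rfl⟩
    apply (FDRep.simple_iff_char_is_norm_one _).mpr
    have h2 := Representation.card_inv_mul_sum_char_mul_char_eq_finrank ρ ρ
    have := hρ
    rw [Representation.IsIrreducible.finrank_intertwiningMap_self, Nat.cast_one,
      inv_mul_eq_one₀ hG] at h2
    exact h2.symm

/-- Maschke induction: a property of finite-dimensional representations which holds for the
irreducible ones and the zero ones and is closed under direct sums holds always. -/
theorem Representation.induction_irreducible {G : Type} [Group G] [Fintype G]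
    (P : ∀ (V : Type) [AddCommGroup V] [Module ℂ V], Representation ℂ G V → Prop)
    (h0 : ∀ (V : Type) [AddCommGroup V] [Module ℂ V] (ρ : Representation ℂ G V),
      Subsingleton V → P V ρ)
    (hi : ∀ (V : Type) [AddCommGroup V] [Module ℂ V] [FiniteDimensional ℂ V]
      (ρ : Representation ℂ G V), ρ.IsIrreducible → P V ρ)
    (hs : ∀ (V : Type) [AddCommGroup V] [Module ℂ V] [FiniteDimensional ℂ V]
      (ρ : Representation ℂ G V) (p q : Subrepresentation ρ),
      IsCompl p.toSubmodule q.toSubmodule → P _ p.toRepresentation → P _ q.toRepresentation →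
      P V ρ)
    (V : Type) [AddCommGroup V] [Module ℂ V] [FiniteDimensional ℂ V]
    (ρ : Representation ℂ G V) : P V ρ := by
  induction hn : Module.finrank ℂ V using Nat.strong_induction_on generalizing V with
  | _ n ih =>
    have hc : ComplementedLattice (Subrepresentation ρ) := inferInstance
    by_cases hV : Subsingleton V
    · exact h0 V ρ hV
    rw [not_subsingleton_iff_nontrivial] at hV
    by_cases hirr : ρ.IsIrreducible
    · exact hi V ρ hirr
    have : Nontrivial (Subrepresentation ρ) := ⟨⊥, ⊤, fun hb => by
      have : (⊥ : Submodule ℂ V) = ⊤ := congrArg Subrepresentation.toSubmodule hb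
      exact bot_ne_top this⟩
    have : ∃ p : Subrepresentation ρ, p ≠ ⊥ ∧ p ≠ ⊤ := by
      by_contra! hcon
      exact hirr ⟨fun p => or_iff_not_imp_left.mpr (hcon p)⟩
    obtain ⟨p, hpb, hpt⟩ := this
    obtain ⟨q, hpq⟩ := exists_isCompl p
    have hpq' : IsCompl p.toSubmodule q.toSubmodule := by
      constructor
      · rw [disjoint_iff]
        exact congrArg Subrepresentation.toSubmodule hpq.inf_eq_bot
      · rw [codisjoint_iff]
        exact congrArg Subrepresentation.toSubmodule hpq.sup_eq_top
    have hsum := Submodule.finrank_add_eq_of_isCompl hpq'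
    have hp : 0 < Module.finrank ℂ p.toSubmodule := by
      refine Nat.pos_of_ne_zero fun h => hpb ?_
      exact Subrepresentation.toSubmodule_injective (Submodule.finrank_eq_zero.mp h)
    have hq : 0 < Module.finrank ℂ q.toSubmodule := by
      refine Nat.pos_of_ne_zero fun h => hpt ?_
      apply Subrepresentation.toSubmodule_injective
      have := hpq'.sup_eq_top
      rwa [Submodule.finrank_eq_zero.mp h, sup_bot_eq] at this
    exact hs V ρ p q hpq' (ih _ (by omega) _ p.toRepresentation rfl)
      (ih _ (by omega) _ q.toRepresentation rfl)

theorem LinearMap.trace_eq_add_of_isCompl {V : Type} [AddCommGroup V] [Module ℂ V]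
    [FiniteDimensional ℂ V] {p q : Submodule ℂ V} (h : IsCompl p q) (f : V →ₗ[ℂ] V)
    (hp : ∀ x ∈ p, f x ∈ p) (hq : ∀ x ∈ q, f x ∈ q) :
    LinearMap.trace ℂ V f = LinearMap.trace ℂ p (f.restrict hp) +
      LinearMap.trace ℂ q (f.restrict hq) := by
  have hN : DirectSum.IsInternal (fun b : Bool => cond b p q) :=
    DirectSum.isInternal_submodule_of_iSupIndep_of_iSup_eq_top
      ((iSupIndep_pair (i := true) (j := false) (by simp) (by rintro (_|_) <;> simp)).mpr
        h.disjoint) (by rw [iSup_bool_eq]; exact h.sup_eq_top)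
  have hf : ∀ b, Set.MapsTo f (cond b p q : Submodule ℂ V) (cond b p q : Submodule ℂ V) := by
    rintro (_|_)
    · exact hq
    · exact hp
  have := LinearMap.trace_eq_sum_trace_restrict hN hf
  rw [this, Fintype.sum_bool]
  rfl

theorem Representation.isVirtualChar_character {G : Type} [Group G] [Fintype G]
    (V : Type) [AddCommGroup V] [Module ℂ V] [FiniteDimensional ℂ V]
    (ρ : Representation ℂ G V) : IsVirtualChar G ρ.character := by
  refine Representation.induction_irreducible
    (fun V _ _ ρ => IsVirtualChar G ρ.character) ?_ ?_ ?_ V ρ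
  · intro V _ _ ρ hV
    have : ρ.character = 0 := by
      ext g
      rw [Representation.character, Subsingleton.elim (ρ g) 0, map_zero]
      rfl
    rw [this]
    exact Submodule.zero_mem _
  · intro V _ _ _ ρ hρ
    exact Submodule.subset_span (isIrrChar_iff.mpr ⟨V, _, _, inferInstance, ρ, hρ, rfl⟩)
  · intro V _ _ _ ρ p q hpq h1 h2
    have : ρ.character = p.toRepresentation.character + q.toRepresentation.character := by
      ext g
      exact LinearMap.trace_eq_add_of_isCompl hpq (ρ g) (p.apply_mem_toSubmodule g)
        (q.apply_mem_toSubmodule g)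
    rw [this]
    exact Submodule.add_mem _ h1 h2

namespace IsVirtualChar

variable {G : Type} [Group G] [Fintype G] {φ ψ : G → ℂ}

omit [Fintype G] in
theorem of_isIrrChar (h : IsIrrChar G φ) : IsVirtualChar G φ := Submodule.subset_span h

omit [Fintype G] in
theorem add (hφ : IsVirtualChar G φ) (hψ : IsVirtualChar G ψ) : IsVirtualChar G (φ + ψ) :=
  Submodule.add_mem _ hφ hψ

omit [Fintype G] in
theorem sub (hφ : IsVirtualChar G φ) (hψ : IsVirtualChar G ψ) : IsVirtualChar G (φ - ψ) :=
  Submodule.sub_mem _ hφ hψ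

theorem mul (hφ : IsVirtualChar G φ) (hψ : IsVirtualChar G ψ) : IsVirtualChar G (φ * ψ) := by
  have hle := Submodule.mul_mem_mul (M := Submodule.span ℤ {f : G → ℂ | IsIrrChar G f}) hφ hψ
  rw [Submodule.span_mul_span] at hle
  refine Submodule.span_le.mpr ?_ hle
  rintro _ ⟨f, hf, g, hg, rfl⟩
  obtain ⟨V, _, _, _, ρ, -, rfl⟩ := isIrrChar_iff.mp hf
  obtain ⟨W, _, _, _, σ, -, rfl⟩ := isIrrChar_iff.mp hg
  change IsVirtualChar G (ρ.character * σ.character)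
  rw [← Representation.char_tensor]
  exact Representation.isVirtualChar_character _ _

theorem one : IsVirtualChar G 1 := by
  have : (1 : G → ℂ) = (Representation.trivial ℂ G ℂ).character := by
    ext g
    simp [Representation.character]
  rw [this]
  exact Representation.isVirtualChar_character _ _

theorem natCast (n : ℕ) : IsVirtualChar G (n : G → ℂ) := by
  induction n with
  | zero => exact_mod_cast Submodule.zero_mem _
  | succ n ih => push_cast; exact ih.add one

/-- The permutation representation on functions on a `G`-set. -/
def _root_.Representation.onFunctions (G X : Type) [Group G] [MulAction G X] :
    Representation ℂ G (X → ℂ) where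
  toFun g := LinearMap.funLeft ℂ ℂ fun x => g⁻¹ • x
  map_one' := by ext; simp [LinearMap.funLeft]
  map_mul' g h := by ext; simp [LinearMap.funLeft, mul_smul]

/-- The permutation character of a finite `G`-set. -/
theorem card_fixedBy (X : Type) [Fintype X] [MulAction G X] :
    IsVirtualChar G fun g => (Nat.card (MulAction.fixedBy X g) : ℂ) := by
  classical
  have : (fun g : G => (Nat.card (MulAction.fixedBy X g) : ℂ)) =
      (Representation.onFunctions G X).character := by
    ext g
    rw [Representation.character, LinearMap.trace_eq_matrix_trace ℂ (Pi.basisFun ℂ X),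
      Matrix.trace]
    simp [MulAction.fixedBy, Nat.card_eq_fintype_card, Fintype.card_subtype,
      Matrix.diag, Representation.onFunctions, LinearMap.funLeft,
      Pi.single_apply]
    refine congrArg _ (Finset.filter_congr fun x _ => ?_)
    rw [inv_smul_eq_iff, eq_comm]
  rw [this]
  exact Representation.isVirtualChar_character _ _

theorem regChar : IsVirtualChar G (regChar G) := by
  convert card_fixedBy (G := G) G using 1
  ext g
  unfold _root_.regChar
  split_ifs with h
  · subst h
    simp [Nat.card_eq_fintype_card]
  · have : MulAction.fixedBy G g = ∅ := by
      ext x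
      simp [h]
    rw [this]
    simp

end IsVirtualChar

/-- A nonzero element of the group algebra acts nontrivially on some irreducible
representation. -/
theorem exists_irreducible_sum_ne_zero {G ι : Type} [Group G] [Fintype G] [Fintype ι] (g : ι → G)
    (hg : Function.Injective g) (c : ι → ℂ) (hc : c ≠ 0) :
    ∃ (V : Type) (_ : AddCommGroup V) (_ : Module ℂ V) (_ : FiniteDimensional ℂ V)
      (ρ : Representation ℂ G V), ρ.IsIrreducible ∧ ∑ i, c i • ρ (g i) ≠ 0 := by
  classical
  by_contra! hcon
  have key := Representation.induction_irreducible (G := G)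
    (fun V _ _ ρ => ∑ i, c i • ρ (g i) = 0) (fun V _ _ ρ _ => Subsingleton.elim _ _)
    (fun V _ _ _ ρ hρ => hcon V _ _ inferInstance ρ hρ) ?_ (G → ℂ)
    (Representation.onFunctions G G)
  · apply hc
    ext i
    have h1 := congrFun (congrArg (fun f => f (Pi.single 1 1)) key) (g i)
    simpa [Representation.onFunctions, LinearMap.funLeft, Pi.single_apply, inv_mul_eq_one,
      hg.eq_iff] using h1
  · intro V _ _ _ ρ p q hpq h1 h2
    ext v
    obtain ⟨a, ha, b, hb, rfl⟩ := Submodule.mem_sup.mp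
      (show v ∈ p.toSubmodule ⊔ q.toSubmodule by rw [hpq.sup_eq_top]; trivial)
    have h1' : (∑ i, c i • ρ (g i)) a = 0 := by
      have := congrArg (fun f => ((f ⟨a, ha⟩ : p.toSubmodule) : V)) h1
      simpa [LinearMap.sum_apply, Subrepresentation.toRepresentation] using this
    have h2' : (∑ i, c i • ρ (g i)) b = 0 := by
      have := congrArg (fun f => ((f ⟨b, hb⟩ : q.toSubmodule) : V)) h2
      simpa [LinearMap.sum_apply, Subrepresentation.toRepresentation] using this
    rw [map_add, h1', h2', add_zero, LinearMap.zero_apply]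

namespace SL2

open Matrix

variable {F : Type} [Field F]

/-- Upper unipotent elements of `SL₂`. -/
def u (x : F) : SpecialLinearGroup (Fin 2) F := ⟨!![1, x; 0, 1], by simp⟩

/-- Diagonal elements of `SL₂`. -/
def t (a : Fˣ) : SpecialLinearGroup (Fin 2) F := ⟨!![(a : F), 0; 0, (a⁻¹ : Fˣ)], by simp⟩

/-- Antidiagonal elements of `SL₂`. -/
def n (c : Fˣ) : SpecialLinearGroup (Fin 2) F := ⟨!![0, -((c⁻¹ : Fˣ) : F); (c : F), 0], by simp⟩

theorem coe_u (x : F) : (u x : Matrix (Fin 2) (Fin 2) F) = !![1, x; 0, 1] := rfl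

theorem coe_t (a : Fˣ) :
    (t a : Matrix (Fin 2) (Fin 2) F) = !![(a : F), 0; 0, (a⁻¹ : Fˣ)] := rfl

theorem coe_n (c : Fˣ) :
    (n c : Matrix (Fin 2) (Fin 2) F) = !![0, -((c⁻¹ : Fˣ) : F); (c : F), 0] := rfl

theorem ext_coe {g h : SpecialLinearGroup (Fin 2) F}
    (H : (g : Matrix (Fin 2) (Fin 2) F) = h) : g = h := Subtype.ext H

theorem u_zero : u (0 : F) = 1 := ext_coe (by simp [coe_u, one_fin_two])

theorem u_add (x y : F) : u (x + y) = u x * u y :=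
  ext_coe (by simp [coe_u, add_comm])

theorem t_one : t (1 : Fˣ) = 1 := ext_coe (by simp [coe_t, one_fin_two])

theorem t_mul (a b : Fˣ) : t (a * b) = t a * t b :=
  ext_coe (by simp [coe_t, mul_comm])

theorem t_neg_one : t (-1 : Fˣ) = -1 := ext_coe (by simp [coe_t, one_fin_two])

theorem t_mul_u (a : Fˣ) (x : F) : t a * u x = u ((a : F) ^ 2 * x) * t a :=
  ext_coe (by simp [coe_u, coe_t]; field_simp)

theorem n_mul_t (c a : Fˣ) : n c * t a = n (c * a) :=
  ext_coe (by simp [coe_n, coe_t, mul_comm])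

theorem t_mul_n (a c : Fˣ) : t a * n c = n (c * a⁻¹) :=
  ext_coe (by simp [coe_n, coe_t, mul_comm])

theorem n_mul_n (c d : Fˣ) : n c * n d = t (-(d * c⁻¹)) :=
  ext_coe (by simp [coe_n, coe_t, mul_comm])

theorem n_mul_u_mul_n (c d x : Fˣ) : n c * u (x : F) * n d =
    u (-((c : F) ^ 2 * x)⁻¹) * n (c * x * d) * u (-((d : F) ^ 2 * x)⁻¹) :=
  ext_coe (by
    simp [coe_n, coe_u]
    refine ⟨⟨?_, ?_⟩, ?_⟩ <;> field_simp
    ring)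

theorem bruhat (g : SpecialLinearGroup (Fin 2) F) :
    (∃ a x, g = t a * u x) ∨ ∃ x c y, g = u x * n c * u y := by
  have hdet := g.det_coe
  rw [det_fin_two] at hdet
  by_cases hc : g 1 0 = 0
  · left
    rw [hc, mul_zero, sub_zero] at hdet
    have ha : g 0 0 ≠ 0 := left_ne_zero_of_mul_eq_one hdet
    refine ⟨Units.mk0 _ ha, (g 0 0)⁻¹ * g 0 1, ext_coe ?_⟩
    ext i j
    fin_cases i <;> fin_cases j <;> simp [coe_t, coe_u, hc, ha]
    exact eq_inv_of_mul_eq_one_right hdet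
  · right
    refine ⟨g 0 0 * (g 1 0)⁻¹, Units.mk0 _ hc, (g 1 0)⁻¹ * g 1 1, ext_coe ?_⟩
    ext i j
    fin_cases i <;> fin_cases j <;> simp [coe_n, coe_u, hc]
    field_simp
    linear_combination -hdet

theorem t_mul_u_injective : Function.Injective fun p : Fˣ × F => t p.1 * u p.2 := by
  rintro ⟨a, x⟩ ⟨b, y⟩ h
  have h := congrArg (fun g : SpecialLinearGroup (Fin 2) F => (g : Matrix (Fin 2) (Fin 2) F)) h
  simp [coe_t, coe_u] at h
  obtain ⟨⟨hab, h⟩, -⟩ := h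
  obtain rfl := Units.ext hab
  simpa using h

theorem u_mul_n_mul_u_injective :
    Function.Injective fun p : F × Fˣ × F => u p.1 * n p.2.1 * u p.2.2 := by
  rintro ⟨x, c, y⟩ ⟨x', c', y'⟩ h
  have h := congrArg (fun g : SpecialLinearGroup (Fin 2) F => (g : Matrix (Fin 2) (Fin 2) F)) h
  simp [coe_n, coe_u] at h
  obtain ⟨⟨h1, -⟩, hc, h2⟩ := h
  obtain rfl := Units.ext hc
  simp at h1 h2
  simp [h1, h2]

theorem card_eq [Fintype F] : Nat.card (SpecialLinearGroup (Fin 2) F) =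
    (Fintype.card F + 1) * (Fintype.card F * (Fintype.card F - 1)) := by
  classical
  have hb : Function.Bijective (Sum.elim (fun p : Fˣ × F => t p.1 * u p.2)
      (fun p : F × Fˣ × F => u p.1 * n p.2.1 * u p.2.2)) := by
    constructor
    · refine t_mul_u_injective.sumElim u_mul_n_mul_u_injective ?_
      rintro ⟨a, x⟩ ⟨y, c, z⟩ h
      have h := congrArg (fun g : SpecialLinearGroup (Fin 2) F => g 1 0) h
      simp [coe_t, coe_u, coe_n] at h
      exact c.ne_zero h.symm
    · intro g
      rcases bruhat g with ⟨a, x, rfl⟩ | ⟨x, c, y, rfl⟩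
      · exact ⟨Sum.inl (a, x), rfl⟩
      · exact ⟨Sum.inr (x, c, y), rfl⟩
  rw [← Nat.card_congr (Equiv.ofBijective _ hb), Nat.card_eq_fintype_card]
  simp only [Fintype.card_sum, Fintype.card_prod, Fintype.card_units]
  ring

/-- The anti-automorphism of `SL₂` which exchanges the diagonal entries. -/
def flip (g : SpecialLinearGroup (Fin 2) F) : SpecialLinearGroup (Fin 2) F :=
  ⟨!![g 1 1, g 0 1; g 1 0, g 0 0], by
    have := g.det_coe
    rw [det_fin_two] at this
    rw [det_fin_two_of, mul_comm, this]⟩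

theorem coe_flip (g : SpecialLinearGroup (Fin 2) F) :
    (flip g : Matrix (Fin 2) (Fin 2) F) = !![g 1 1, g 0 1; g 1 0, g 0 0] := rfl

theorem flip_mul (g h : SpecialLinearGroup (Fin 2) F) : flip (g * h) = flip h * flip g := by
  refine ext_coe ?_
  ext i j
  fin_cases i <;> fin_cases j <;>
    simp [coe_flip, mul_apply, Fin.sum_univ_two] <;> ring

theorem flip_u (x : F) : flip (u x) = u x := ext_coe (by simp [coe_flip, coe_u])

theorem flip_n (c : Fˣ) : flip (n c) = n c := ext_coe (by simp [coe_flip, coe_n])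

theorem flip_t (a : Fˣ) : flip (t a) = t a⁻¹ := ext_coe (by simp [coe_flip, coe_t])

/-- `SL₂` acts on the projective line by Möbius transformations. -/
noncomputable instance : MulAction (SpecialLinearGroup (Fin 2) F) (OnePoint F) :=
  open Classical in MulAction.compHom _ (SpecialLinearGroup.toGL (n := Fin 2) (R := F))

open Classical in
theorem smul_infty (g : SpecialLinearGroup (Fin 2) F) :
    g • (OnePoint.infty : OnePoint F) =
      if g 1 0 = 0 then OnePoint.infty else ((g 0 0 / g 1 0 : F) : OnePoint F) :=
  OnePoint.smul_infty_eq_ite (SpecialLinearGroup.toGL g)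

open Classical in
theorem smul_coe (g : SpecialLinearGroup (Fin 2) F) (x : F) :
    g • (x : OnePoint F) = if g 1 0 * x + g 1 1 = 0 then OnePoint.infty else
      (((g 0 0 * x + g 0 1) / (g 1 0 * x + g 1 1) : F) : OnePoint F) :=
  OnePoint.smul_some_eq_ite (g := SpecialLinearGroup.toGL g)

theorem t_mul_u_smul_infty (a : Fˣ) (x : F) :
    (t a * u x) • (OnePoint.infty : OnePoint F) = OnePoint.infty := by
  classical
  rw [smul_infty, if_pos]
  simp [coe_t, coe_u]

theorem u_mul_n_mul_u_smul_infty (x : F) (c : Fˣ) (y : F) :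
    (u x * n c * u y) • (OnePoint.infty : OnePoint F) = (x : OnePoint F) := by
  classical
  rw [smul_infty, if_neg] <;> simp [coe_n, coe_u]

theorem t_mul_u_smul_coe (a : Fˣ) (x y : F) :
    (t a * u x) • (y : OnePoint F) = ((a : F) ^ 2 * (y + x) : F) := by
  classical
  rw [smul_coe, if_neg]
  · congr 1
    simp [coe_t, coe_u]
    ring
  · simp [coe_t, coe_u]

/-- The number of fixed points on the projective line. -/
noncomputable def fixedPoints (g : SpecialLinearGroup (Fin 2) F) : ℕ :=
  Nat.card (MulAction.fixedBy (OnePoint F) g)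

theorem exists_conj_of_fixedPoints_ne_zero {g : SpecialLinearGroup (Fin 2) F}
    (hg : fixedPoints g ≠ 0) : ∃ h a x, g = h * (t a * u x) * h⁻¹ := by
  obtain ⟨⟨p, hp⟩⟩ : Nonempty (MulAction.fixedBy (OnePoint F) g) :=
    (Nat.card_ne_zero.mp hg).1
  obtain ⟨h, rfl⟩ : ∃ h : SpecialLinearGroup (Fin 2) F, h • (OnePoint.infty : OnePoint F) = p := by
    induction p using OnePoint.rec with
    | infty => exact ⟨1, one_smul _ _⟩
    | coe x => exact ⟨_, u_mul_n_mul_u_smul_infty x 1 0⟩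
  rw [MulAction.mem_fixedBy] at hp
  rcases bruhat (h⁻¹ * g * h) with ⟨a, x, hax⟩ | ⟨x, c, y, hxy⟩
  · refine ⟨h, a, x, ?_⟩
    rw [← hax]
    group
  · have := u_mul_n_mul_u_smul_infty x c y
    rw [← hxy, mul_smul, mul_smul, hp, inv_smul_smul] at this
    exact absurd this (OnePoint.infty_ne_coe x)

theorem fixedPoints_conj (g h : SpecialLinearGroup (Fin 2) F) :
    fixedPoints (h * g * h⁻¹) = fixedPoints g := by
  refine Nat.card_congr ⟨fun p => ⟨h⁻¹ • p.1, ?_⟩, fun p => ⟨h • p.1, ?_⟩, fun p => ?_, fun p => ?_⟩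
  · have := p.2
    rw [MulAction.mem_fixedBy, mul_smul, mul_smul] at this
    rw [MulAction.mem_fixedBy, eq_inv_smul_iff, this]
  · have := p.2
    rw [MulAction.mem_fixedBy] at this
    rw [MulAction.mem_fixedBy, mul_smul, mul_smul, inv_smul_smul, this]
  · simp
  · simp

section Finite

variable [Fintype F]

theorem fixedPoints_eq_of_fixes_infty {g : SpecialLinearGroup (Fin 2) F}
    (hg : g • (OnePoint.infty : OnePoint F) = OnePoint.infty) :
    fixedPoints g = Nat.card {y : F // g • (y : OnePoint F) = y} + 1 := by
  rw [← Finite.card_option]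
  refine Nat.card_congr (Equiv.symm (Equiv.ofBijective
    (fun o : Option {y : F // g • (y : OnePoint F) = y} => o.elim ⟨OnePoint.infty, hg⟩
      fun y => ⟨y.1, y.2⟩) ⟨?_, ?_⟩))
  · rintro (_ | a) (_ | b) h
    · rfl
    · exact absurd (congrArg Subtype.val h) (OnePoint.infty_ne_coe _)
    · exact absurd (congrArg Subtype.val h) (OnePoint.coe_ne_infty _)
    · exact congrArg some (Subtype.ext (OnePoint.coe_injective (congrArg Subtype.val h)))
  · rintro ⟨p, hp⟩
    induction p using OnePoint.rec with
    | infty => exact ⟨none, rfl⟩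
    | coe x => exact ⟨some ⟨x, hp⟩, rfl⟩

theorem fixedPoints_t_mul_u (a : Fˣ) (x : F) :
    fixedPoints (t a * u x) = Nat.card {y : F // (a : F) ^ 2 * (y + x) = y} + 1 := by
  rw [fixedPoints_eq_of_fixes_infty (t_mul_u_smul_infty a x)]
  simp only [t_mul_u_smul_coe, OnePoint.coe_eq_coe]

theorem fixedPoints_t_mul_u_of_sq_ne {a : Fˣ} (ha : (a : F) ^ 2 ≠ 1) (x : F) :
    fixedPoints (t a * u x) = 2 := by
  rw [fixedPoints_t_mul_u]
  have h1 : 1 - (a : F) ^ 2 ≠ 0 := sub_ne_zero.mpr ha.symm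
  have : ∀ y, (a : F) ^ 2 * (y + x) = y ↔ y = (1 - (a : F) ^ 2)⁻¹ * ((a : F) ^ 2 * x) := by
    intro y
    rw [eq_inv_mul_iff_mul_eq₀ h1]
    constructor <;> intro h <;> linear_combination -h
  simp [this]

theorem fixedPoints_t_mul_u_of_sq_eq {a : Fˣ} (ha : (a : F) ^ 2 = 1) {x : F} (hx : x ≠ 0) :
    fixedPoints (t a * u x) = 1 := by
  rw [fixedPoints_t_mul_u]
  simp [ha, hx]

theorem fixedPoints_t_of_sq_eq {a : Fˣ} (ha : (a : F) ^ 2 = 1) :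
    fixedPoints (t a) = Fintype.card F + 1 := by
  have := fixedPoints_t_mul_u a 0
  rw [u_zero, mul_one] at this
  rw [this]
  simp [ha]

theorem fixedPoints_one : fixedPoints (1 : SpecialLinearGroup (Fin 2) F) = Fintype.card F + 1 := by
  rw [← t_one]
  exact fixedPoints_t_of_sq_eq (by simp)

theorem isVirtualChar_fixedPoints :
    IsVirtualChar (SpecialLinearGroup (Fin 2) F) fun g => (fixedPoints g : ℂ) := by
  classical
  exact IsVirtualChar.card_fixedBy (OnePoint F)

end Finite

end SL2

namespace SL2

open Matrix

variable {F : Type} [Field F] [Fintype F] {V : Type} [AddCommGroup V] [Module ℂ V]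
  (ρ : Representation ℂ (SpecialLinearGroup (Fin 2) F) V) (ψ : AddChar F ℂ)

/-- The projection onto the subspace on which `u x` acts by `ψ (s * x)`. -/
noncomputable def proj (s : F) : Module.End ℂ V :=
  (Fintype.card F : ℂ)⁻¹ • ∑ x, ψ (-(s * x)) • ρ (u x)

theorem map_u_mul_proj (x s : F) : ρ (u x) * proj ρ ψ s = ψ (s * x) • proj ρ ψ s := by
  rw [proj, mul_smul_comm, smul_comm (ψ (s * x)), Finset.mul_sum]
  congr 1
  rw [Finset.smul_sum]
  refine Fintype.sum_equiv (Equiv.addLeft x) _ _ fun y => ?_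
  rw [Equiv.coe_addLeft, mul_smul_comm, ← map_mul, ← u_add, smul_smul, ← AddChar.map_add_eq_mul]
  congr 2
  ring

theorem commute_map_u_proj (x s : F) : ρ (u x) * proj ρ ψ s = proj ρ ψ s * ρ (u x) := by
  rw [proj, mul_smul_comm, smul_mul_assoc, Finset.mul_sum, Finset.sum_mul]
  congr 1
  refine Finset.sum_congr rfl fun y _ => ?_
  rw [mul_smul_comm, smul_mul_assoc, ← map_mul, ← map_mul, ← u_add, ← u_add, add_comm]

theorem proj_mul_map_u (s x : F) : proj ρ ψ s * ρ (u x) = ψ (s * x) • proj ρ ψ s := by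
  rw [← commute_map_u_proj, map_u_mul_proj]

theorem map_t_mul_proj (a : Fˣ) (s : F) :
    ρ (t a) * proj ρ ψ s = proj ρ ψ (s * ((a⁻¹ : Fˣ) : F) ^ 2) * ρ (t a) := by
  rw [proj, proj, mul_smul_comm, smul_mul_assoc, Finset.mul_sum, Finset.sum_mul]
  congr 1
  refine Fintype.sum_equiv (Equiv.mulLeft₀ ((a : F) ^ 2) (pow_ne_zero 2 a.ne_zero)) _ _ fun y => ?_
  change ρ (t a) * ψ (-(s * y)) • ρ (u y) = ψ (-(s * ((a⁻¹ : Fˣ) : F) ^ 2 * ((a : F) ^ 2 * y))) •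
    ρ (u ((a : F) ^ 2 * y)) * ρ (t a)
  rw [mul_smul_comm, smul_mul_assoc, ← map_mul, ← map_mul, t_mul_u]
  congr 2
  simp only [Units.val_inv_eq_inv_val]
  field_simp

variable {ψ}

theorem proj_mul_proj_self (s : F) : proj ρ ψ s * proj ρ ψ s = proj ρ ψ s := by
  have hq : (Fintype.card F : ℂ) ≠ 0 := Nat.cast_ne_zero.mpr Fintype.card_ne_zero
  conv_lhs => enter [1]; rw [proj]
  rw [smul_mul_assoc, Finset.sum_mul]
  simp only [smul_mul_assoc, map_u_mul_proj, smul_smul, ← AddChar.map_add_eq_mul,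
    neg_add_cancel, AddChar.map_zero_eq_one, one_smul]
  rw [Finset.sum_const, Finset.card_univ, ← Nat.cast_smul_eq_nsmul ℂ, smul_smul,
    inv_mul_cancel₀ hq, one_smul]

theorem proj_mul_proj_of_ne (hψ : ψ.IsPrimitive) {s r : F} (h : s ≠ r) :
    proj ρ ψ s * proj ρ ψ r = 0 := by
  classical
  conv_lhs => enter [1]; rw [proj]
  rw [smul_mul_assoc, Finset.sum_mul]
  simp only [smul_mul_assoc, map_u_mul_proj, smul_smul, ← AddChar.map_add_eq_mul]
  rw [← Finset.sum_smul]
  have := AddChar.sum_mulShift (r - s) hψ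
  rw [if_neg (sub_ne_zero.mpr h.symm)] at this
  rw [Finset.sum_congr rfl fun x _ => show ψ (-(s * x) + r * x) = ψ (x * (r - s)) by congr 1; ring,
    this]
  simp

theorem sum_proj (hψ : ψ.IsPrimitive) : ∑ s, proj ρ ψ s = 1 := by
  classical
  have hq : (Fintype.card F : ℂ) ≠ 0 := Nat.cast_ne_zero.mpr Fintype.card_ne_zero
  simp only [proj]
  rw [← Finset.smul_sum, Finset.sum_comm]
  simp only [← Finset.sum_smul]
  have (x : F) : ∑ s, ψ (-(s * x)) = if x = 0 then (Fintype.card F : ℂ) else 0 := by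
    have := AddChar.sum_mulShift (-x) hψ
    simp only [neg_eq_zero, mul_neg] at this
    rw [this]
    split_ifs <;> simp
  simp only [this, ite_smul, zero_smul, Finset.sum_ite_eq', Finset.mem_univ, if_true, u_zero,
    map_one, smul_smul, inv_mul_cancel₀ hq, one_smul]

theorem proj_apply_proj (s : F) (v : V) : proj ρ ψ s (proj ρ ψ s v) = proj ρ ψ s v :=
  congrArg (fun f : Module.End ℂ V => f v) (proj_mul_proj_self ρ s)

theorem map_u_apply_of_proj {s : F} {v : V} (h : proj ρ ψ s v = v) (x : F) :
    ρ (u x) v = ψ (s * x) • v := by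
  have := congrArg (fun f : Module.End ℂ V => f v) (map_u_mul_proj ρ ψ x s)
  simpa [h] using this

theorem map_u_apply_of_proj_zero {v : V} (h : proj ρ ψ 0 v = v) (x : F) :
    ρ (u x) v = v := by
  simpa using map_u_apply_of_proj ρ h x

variable (ψ)

theorem proj_zero_apply_of_forall {v : V} (h : ∀ x, ρ (u x) v = v) : proj ρ ψ 0 v = v := by
  have hq : (Fintype.card F : ℂ) ≠ 0 := Nat.cast_ne_zero.mpr Fintype.card_ne_zero
  simp [proj, h, ← Nat.cast_smul_eq_nsmul ℂ, smul_smul, hq]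

/-- The dimension of the subspace on which `u x` acts by `ψ (s * x)`. -/
noncomputable def mult (s : F) : ℕ := Module.finrank ℂ (LinearMap.range (proj ρ ψ s))

theorem mult_ne_zero_iff [FiniteDimensional ℂ V] {s : F} : mult ρ ψ s ≠ 0 ↔ proj ρ ψ s ≠ 0 := by
  rw [mult, Ne, Submodule.finrank_eq_zero, LinearMap.range_eq_bot]

theorem exists_of_mult_ne_zero {s : F} (h : mult ρ ψ s ≠ 0) : ∃ v, v ≠ 0 ∧ proj ρ ψ s v = v := by
  by_contra! hcon
  apply h
  have : proj ρ ψ s = 0 := by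
    ext v
    by_contra hv
    exact hcon _ hv (proj_apply_proj ρ s v)
  rw [mult, this, LinearMap.range_zero, finrank_bot]

variable {ψ} [FiniteDimensional ℂ V]

theorem trace_proj (s : F) : LinearMap.trace ℂ V (proj ρ ψ s) = mult ρ ψ s :=
  (LinearMap.IsIdempotentElem.isProj_range (proj ρ ψ s) (proj_mul_proj_self ρ s)).trace

theorem sum_mult (hψ : ψ.IsPrimitive) : ∑ s, mult ρ ψ s = Module.finrank ℂ V := by
  have := congrArg (LinearMap.trace ℂ V) (sum_proj ρ hψ)
  rw [map_sum, LinearMap.trace_one] at this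
  simp only [trace_proj] at this
  exact_mod_cast this

theorem character_u (hψ : ψ.IsPrimitive) (x : F) :
    ρ.character (u x) = ∑ s, ψ (s * x) * mult ρ ψ s := by
  have : ρ (u x) = ∑ s, ψ (s * x) • proj ρ ψ s := by
    simp only [← map_u_mul_proj]
    rw [← Finset.mul_sum, sum_proj ρ hψ, mul_one]
  rw [Representation.character, this, map_sum]
  simp [trace_proj]

theorem mult_mul_sq (s : F) (a : Fˣ) : mult ρ ψ (s * (a : F) ^ 2) = mult ρ ψ s := by
  have h := map_t_mul_proj ρ ψ a⁻¹ s
  rw [inv_inv] at h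
  have h2 : LinearMap.trace ℂ V (proj ρ ψ (s * (a : F) ^ 2)) =
      LinearMap.trace ℂ V (proj ρ ψ s) := by
    have h3 : proj ρ ψ (s * (a : F) ^ 2) = ρ (t a⁻¹) * proj ρ ψ s * ρ (t a) := by
      rw [h, mul_assoc, ← map_mul, ← t_mul, inv_mul_cancel, t_one, map_one, mul_one]
    rw [h3, LinearMap.trace_mul_comm, ← mul_assoc, ← map_mul, ← t_mul, mul_inv_cancel, t_one,
      map_one, one_mul]
  rw [trace_proj, trace_proj] at h2
  exact_mod_cast h2

/-- On a torus element with distinct eigenvalues times a unipotent, the character depends only on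
the unipotent invariants. -/
theorem character_t_mul_u_eq_zero {a : Fˣ} (ha : (a : F) ^ 2 ≠ 1) (h0 : mult ρ ψ 0 = 0) (x : F) :
    ρ.character (t a * u x) = 0 := by
  have h1 : ∀ y, ρ.character (t a * u y) = ρ.character (t a) := by
    intro y
    have h1 : 1 - (a : F) ^ 2 ≠ 0 := sub_ne_zero.mpr ha.symm
    set z := (1 - (a : F) ^ 2)⁻¹ * ((a : F) ^ 2 * y) with hz
    have : t a * u y = u z * t a * (u z)⁻¹ := by
      rw [eq_mul_inv_iff_mul_eq, mul_assoc, ← u_add, t_mul_u]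
      congr 2
      rw [hz]
      field_simp
      ring
    rw [this, Representation.char_conj]
  have h2 : proj ρ ψ 0 = 0 := by
    by_contra h
    exact mult_ne_zero_iff ρ ψ |>.mpr h h0
  have h3 : ∑ y, ρ.character (t a * u y) = 0 := by
    have h4 := congrArg (fun f => LinearMap.trace ℂ V (ρ (t a) * f)) h2
    simp only [proj, zero_mul, neg_zero, AddChar.map_zero_eq_one, one_smul, mul_smul_comm,
      Finset.mul_sum, ← map_mul, map_smul, map_sum, mul_zero, map_zero, smul_eq_mul] at h4
    rw [← Finset.mul_sum] at h4
    exact (mul_eq_zero.mp h4).resolve_left (inv_ne_zero (Nat.cast_ne_zero.mpr Fintype.card_ne_zero))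
  rw [h1]
  simpa [h1] using h3

end SL2

/-- An endomorphism preserving a nonzero subspace has an eigenvector in it. -/
theorem Module.End.exists_eigenvector_mem {V : Type} [AddCommGroup V] [Module ℂ V]
    [FiniteDimensional ℂ V] {W : Submodule ℂ V} (hW : W ≠ ⊥) (f : Module.End ℂ V)
    (hf : ∀ w ∈ W, f w ∈ W) : ∃ v ∈ W, v ≠ 0 ∧ ∃ μ : ℂ, f v = μ • v := by
  have : Nontrivial W := Submodule.nontrivial_iff_ne_bot.mpr hW
  obtain ⟨μ, hμ⟩ := Module.End.exists_eigenvalue (LinearMap.restrict f hf)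
  obtain ⟨v, hv⟩ := hμ.exists_hasEigenvector
  exact ⟨v, v.2, fun h => hv.2 (Subtype.ext h), μ, congrArg Subtype.val hv.apply_eq_smul⟩

theorem Representation.IsIrreducible.range_eq_span {G V : Type} [Group G] [AddCommGroup V]
    [Module ℂ V] {ρ : Representation ℂ G V} (h : ρ.IsIrreducible) {v : V} (hv : v ≠ 0)
    (f : Module.End ℂ V) :
    LinearMap.range f = Submodule.span ℂ (Set.range fun g => f (ρ g v)) := by
  rw [← Submodule.map_top, ← h.span_orbit hv, Submodule.map_span, ← Set.range_comp]
  rfl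

/-- Gelfand's trick: if the compressions of a representation to the range of an idempotent commute,
then this range is at most one-dimensional. -/
theorem Representation.IsIrreducible.finrank_range_le_one {G V : Type} [Group G] [AddCommGroup V]
    [Module ℂ V] [FiniteDimensional ℂ V] {ρ : Representation ℂ G V} (h : ρ.IsIrreducible)
    {E : Module.End ℂ V} (hE : E * E = E)
    (hc : ∀ g k, E * ρ g * E * ρ k * E = E * ρ k * E * ρ g * E) :
    Module.finrank ℂ (LinearMap.range E) ≤ 1 := by
  by_cases hE0 : LinearMap.range E = ⊥
  · rw [hE0, finrank_bot]
    exact zero_le_one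
  have hEw : ∀ w ∈ LinearMap.range E, E w = w := by
    rintro _ ⟨w, rfl⟩
    exact congrArg (fun f : Module.End ℂ V => f w) hE
  have hscalar : ∀ g, ∃ μ : ℂ, ∀ w ∈ LinearMap.range E, E (ρ g w) = μ • w := by
    intro g
    obtain ⟨v, hv, hv0, μ, hμ⟩ := Module.End.exists_eigenvector_mem hE0 (E * ρ g)
      (fun w _ => ⟨_, rfl⟩)
    refine ⟨μ, fun w hw => ?_⟩
    rw [h.range_eq_span hv0 E] at hw
    induction hw using Submodule.span_induction with
    | mem x hx =>
      obtain ⟨k, rfl⟩ := hx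
      have := congrArg (fun f : Module.End ℂ V => f v) (hc g k)
      simp only [Module.End.mul_apply, hEw v hv] at this
      rw [this, show E (ρ g v) = μ • v from hμ, map_smul, map_smul]
    | zero => simp
    | add x y _ _ hx hy => rw [map_add, map_add, hx, hy, smul_add]
    | smul a x _ hx => rw [map_smul, map_smul, hx, smul_comm]
  obtain ⟨v, hv, hv0⟩ := Submodule.exists_mem_ne_zero_of_ne_bot hE0
  have hle : LinearMap.range E ≤ Submodule.span ℂ {v} := by
    rw [h.range_eq_span hv0 E, Submodule.span_le]
    rintro _ ⟨k, rfl⟩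
    obtain ⟨μ, hμ⟩ := hscalar k
    change E (ρ k v) ∈ _
    rw [hμ v hv]
    exact Submodule.smul_mem _ _ (Submodule.mem_span_singleton_self v)
  exact (Submodule.finrank_mono hle).trans (finrank_span_singleton hv0).le

namespace SL2

open Matrix

variable {F : Type} [Field F] [Fintype F] {V : Type} [AddCommGroup V] [Module ℂ V]
  {ρ : Representation ℂ (SpecialLinearGroup (Fin 2) F) V} {ψ : AddChar F ℂ}

theorem proj_mul_map_t_mul_proj (hψ : ψ.IsPrimitive) {r s : F} {a : Fˣ}
    (h : r ≠ s * ((a⁻¹ : Fˣ) : F) ^ 2) : proj ρ ψ r * ρ (t a) * proj ρ ψ s = 0 := by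
  rw [mul_assoc, map_t_mul_proj, ← mul_assoc, proj_mul_proj_of_ne ρ hψ h, zero_mul]

theorem proj_mul_map_flip (hψ : ψ.IsPrimitive) {s : F} (hs : s ≠ 0)
    (g : SpecialLinearGroup (Fin 2) F) :
    proj ρ ψ s * ρ (flip g) * proj ρ ψ s = proj ρ ψ s * ρ g * proj ρ ψ s := by
  rcases bruhat g with ⟨a, x, rfl⟩ | ⟨x, c, y, rfl⟩
  · have h1 : proj ρ ψ s * ρ (flip (t a * u x)) * proj ρ ψ s =
        ψ (s * x) • (proj ρ ψ s * ρ (t a⁻¹) * proj ρ ψ s) := by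
      rw [flip_mul, flip_u, flip_t, map_mul, ← mul_assoc, proj_mul_map_u, smul_mul_assoc,
        smul_mul_assoc]
    have h2 : proj ρ ψ s * ρ (t a * u x) * proj ρ ψ s =
        ψ (s * x) • (proj ρ ψ s * ρ (t a) * proj ρ ψ s) := by
      rw [map_mul, mul_assoc, mul_assoc, map_u_mul_proj, mul_smul_comm, mul_smul_comm, mul_assoc]
    rw [h1, h2]
    by_cases ha : (a : F) ^ 2 = 1
    · have : a⁻¹ = a := by
        rw [inv_eq_iff_mul_eq_one]
        ext
        rw [Units.val_mul, ← sq, ha, Units.val_one]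
      rw [this]
    · rw [proj_mul_map_t_mul_proj hψ, proj_mul_map_t_mul_proj hψ]
      · rw [Units.val_inv_eq_inv_val, inv_pow]
        intro h
        apply ha
        rw [eq_mul_inv_iff_mul_eq₀ (pow_ne_zero 2 a.ne_zero)] at h
        exact mul_left_cancel₀ hs (h.trans (mul_one s).symm)
      · rw [inv_inv]
        exact fun h => ha (mul_left_cancel₀ hs (h.symm.trans (mul_one s).symm))
  · simp only [flip_mul, flip_u, flip_n, map_mul]
    have (x y : F) : proj ρ ψ s * (ρ (u x) * (ρ (n c) * ρ (u y))) * proj ρ ψ s =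
        ψ (s * x) • ψ (s * y) • (proj ρ ψ s * ρ (n c) * proj ρ ψ s) := by
      rw [mul_assoc, mul_assoc, mul_assoc, map_u_mul_proj, ← mul_assoc, proj_mul_map_u]
      simp only [mul_smul_comm, smul_mul_assoc, mul_assoc]
      rw [smul_comm]
    rw [this, mul_assoc (ρ (u x)), this, smul_comm]

theorem mul_proj_mul (E : Module.End ℂ V) (s : F) (g h : SpecialLinearGroup (Fin 2) F) :
    E * ρ g * proj ρ ψ s * ρ h * E =
      (Fintype.card F : ℂ)⁻¹ • ∑ x, ψ (-(s * x)) • (E * ρ (g * u x * h) * E) := by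
  rw [proj]
  simp only [mul_smul_comm, smul_mul_assoc, Finset.mul_sum, Finset.sum_mul, map_mul, mul_assoc]

theorem mult_le_one [FiniteDimensional ℂ V] (hρ : ρ.IsIrreducible) (hψ : ψ.IsPrimitive) {s : F}
    (hs : s ≠ 0) : mult ρ ψ s ≤ 1 := by
  refine hρ.finrank_range_le_one (proj_mul_proj_self ρ s) fun g k => ?_
  have hE (a b : Module.End ℂ V) : proj ρ ψ s * a * proj ρ ψ s * b * proj ρ ψ s =
      (proj ρ ψ s * a * proj ρ ψ s) * (proj ρ ψ s * b * proj ρ ψ s) := by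
    conv_lhs => rw [← proj_mul_proj_self ρ s]
    simp only [mul_assoc]
    simp only [← mul_assoc, proj_mul_proj_self]
  have h1 : proj ρ ψ s * ρ k * proj ρ ψ s * ρ g * proj ρ ψ s =
      proj ρ ψ s * ρ (flip k) * proj ρ ψ s * ρ (flip g) * proj ρ ψ s := by
    rw [hE, hE, proj_mul_map_flip hψ hs, proj_mul_map_flip hψ hs]
  rw [h1, mul_proj_mul, mul_proj_mul]
  congr 1
  refine Finset.sum_congr rfl fun x _ => ?_
  rw [← proj_mul_map_flip hψ hs (g * u x * k), flip_mul, flip_mul, flip_u, mul_assoc (flip k)]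

/-- A nonzero vector invariant under the unipotent subgroup and on which the diagonal subgroup acts
by scalars. -/
structure IsBorelEigenvector (ρ : Representation ℂ (SpecialLinearGroup (Fin 2) F) V) (v : V)
    (α : Fˣ → ℂ) : Prop where
  ne_zero : v ≠ 0
  map_u : ∀ x, ρ (u x) v = v
  map_t : ∀ a, ρ (t a) v = α a • v

theorem exists_isBorelEigenvector [FiniteDimensional ℂ V] (h : mult ρ ψ 0 ≠ 0) :
    ∃ v α, IsBorelEigenvector ρ v α := by
  rw [mult_ne_zero_iff, Ne, ← LinearMap.range_eq_bot] at h
  obtain ⟨ζ, hζ⟩ := IsCyclic.exists_monoid_generator (α := Fˣ)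
  obtain ⟨v, ⟨v', hv'⟩, hv0, μ, hμ⟩ := Module.End.exists_eigenvector_mem h (ρ (t ζ)) (by
    rintro _ ⟨w, rfl⟩
    have := congrArg (fun f : Module.End ℂ V => f w) (map_t_mul_proj ρ ψ ζ 0)
    rw [zero_mul] at this
    exact ⟨_, this.symm⟩)
  have hv : proj ρ ψ 0 v = v := by rw [← hv', proj_apply_proj]
  have : ∀ a, ∃ α : ℂ, ρ (t a) v = α • v := by
    intro a
    obtain ⟨k, rfl⟩ := hζ a
    refine ⟨μ ^ k, ?_⟩
    induction k with
    | zero => simp [t_one]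
    | succ k ih =>
      simp only at ih ⊢
      rw [pow_succ, t_mul, map_mul, Module.End.mul_apply, hμ, map_smul, ih, smul_smul, pow_succ,
        mul_comm]
  choose α hα using this
  exact ⟨v, α, hv0, fun x => map_u_apply_of_proj_zero ρ hv x, hα⟩

namespace IsBorelEigenvector

variable {v : V} {α : Fˣ → ℂ}

omit [Fintype F] in
theorem map_u_mul_n_mul_u (h : IsBorelEigenvector ρ v α) (x : F) (c : Fˣ) (y : F) :
    ρ (u x * n c * u y) v = α c • ρ (u x * n 1) v := by
  rw [map_mul _ (u x * n c), Module.End.mul_apply, h.map_u, ← one_mul c, ← n_mul_t, ← mul_assoc,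
    map_mul _ (u x * n 1), Module.End.mul_apply, h.map_t, map_smul, one_mul]

omit [Fintype F] in
theorem map_t_mul_u (h : IsBorelEigenvector ρ v α) (a : Fˣ) (x : F) :
    ρ (t a * u x) v = α a • v := by
  rw [map_mul, Module.End.mul_apply, h.map_u, h.map_t]

/-- Vectors, indexed by the projective line, which are permuted up to scalars. -/
def vec (ρ : Representation ℂ (SpecialLinearGroup (Fin 2) F) V) (v : V) (p : OnePoint F) : V :=
  p.elim v fun x => ρ (u x * n 1) v

omit [Fintype F] in
theorem exists_map_eq_smul_vec (h : IsBorelEigenvector ρ v α)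
    (g : SpecialLinearGroup (Fin 2) F) :
    ∃ c : ℂ, ρ g v = c • vec ρ v (g • (OnePoint.infty : OnePoint F)) := by
  rcases bruhat g with ⟨a, x, rfl⟩ | ⟨x, c, y, rfl⟩
  · exact ⟨α a, by rw [h.map_t_mul_u, t_mul_u_smul_infty]; rfl⟩
  · exact ⟨α c, by rw [h.map_u_mul_n_mul_u, u_mul_n_mul_u_smul_infty]; rfl⟩

omit [Fintype F] in
theorem span_vec (h : IsBorelEigenvector ρ v α) (hρ : ρ.IsIrreducible) :
    Submodule.span ℂ (Set.range (vec ρ v)) = ⊤ := by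
  rw [eq_top_iff, ← hρ.span_orbit h.ne_zero, Submodule.span_le]
  rintro _ ⟨g, rfl⟩
  obtain ⟨c, hc⟩ := h.exists_map_eq_smul_vec g
  change ρ g v ∈ _
  rw [hc]
  exact Submodule.smul_mem _ _ (Submodule.subset_span ⟨_, rfl⟩)

omit [Field F] in
theorem card_onePoint : Nat.card (OnePoint F) = Fintype.card F + 1 := by
  rw [← Nat.card_eq_fintype_card]
  exact Finite.card_option

theorem finrank_le (h : IsBorelEigenvector ρ v α) (hρ : ρ.IsIrreducible) :
    Module.finrank ℂ V ≤ Fintype.card F + 1 := by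
  classical
  rw [← finrank_top, ← h.span_vec hρ, ← card_onePoint, Nat.card_eq_fintype_card]
  exact finrank_range_le_card _

theorem character_eq_zero (h : IsBorelEigenvector ρ v α) (hρ : ρ.IsIrreducible)
    (hd : Module.finrank ℂ V = Fintype.card F + 1) {g : SpecialLinearGroup (Fin 2) F}
    (hg : fixedPoints g = 0) : ρ.character g = 0 := by
  classical
  let b := basisOfTopLeSpanOfCardEqFinrank (vec ρ v) (h.span_vec hρ).ge
    (by rw [hd, ← card_onePoint, Nat.card_eq_fintype_card])
  rw [Representation.character, LinearMap.trace_eq_matrix_trace ℂ b, Matrix.trace]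
  refine Finset.sum_eq_zero fun p _ => ?_
  have hp : g • p ≠ p := fun hp => by
    rw [fixedPoints, Nat.card_eq_zero] at hg
    rcases hg with hg | hg
    · exact hg.elim ⟨p, hp⟩
    · have : Finite (OnePoint F) := inferInstanceAs (Finite (Option F))
      exact hg.not_finite (Subtype.finite)
  obtain ⟨k, rfl, hk⟩ : ∃ k : SpecialLinearGroup (Fin 2) F,
      k • (OnePoint.infty : OnePoint F) = p ∧ ρ k v = vec ρ v p := by
    induction p using OnePoint.rec with
    | infty => exact ⟨1, one_smul _ _, by simp [vec]⟩
    | coe x =>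
      exact ⟨u x * n 1, by simpa [u_zero] using u_mul_n_mul_u_smul_infty x 1 0, rfl⟩
  obtain ⟨c, hc⟩ := h.exists_map_eq_smul_vec (g * k)
  rw [mul_smul] at hc
  have hb : ∀ p, b p = vec ρ v p := fun p => by simp [b]
  rw [Matrix.diag, LinearMap.toMatrix_apply, hb, ← hk, ← Module.End.mul_apply, ← map_mul, hc, ← hb,
    LinearEquiv.map_smul, Module.Basis.repr_self, Finsupp.smul_apply,
    Finsupp.single_eq_of_ne' hp, smul_zero]

end IsBorelEigenvector

theorem finrank_eq_one_of_mult_eq_zero [FiniteDimensional ℂ V] (hρ : ρ.IsIrreducible)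
    (hψ : ψ.IsPrimitive) (h : ∀ s ≠ 0, mult ρ ψ s = 0) : Module.finrank ℂ V = 1 := by
  have hV := hρ.nontrivial
  have h0 : proj ρ ψ 0 = 1 := by
    rw [← sum_proj ρ hψ, eq_comm]
    refine Finset.sum_eq_single 0 (fun s _ hs => ?_) (by simp)
    by_contra hne
    exact (mult_ne_zero_iff ρ ψ).mpr hne (h s hs)
  have hu : ∀ x, ρ (u x) = 1 := fun x => by
    ext v
    exact map_u_apply_of_proj_zero (ψ := ψ) ρ (by rw [h0]; rfl) x
  have hn : ρ (n (1 : Fˣ)) = 1 := by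
    have h1 := congrArg ρ (n_mul_u_mul_n (1 : Fˣ) 1 1)
    simp only [map_mul, hu, one_mul, mul_one] at h1
    have h2 : ρ (n (1 : Fˣ)) * ρ (n (1 : Fˣ))⁻¹ = 1 := by
      rw [← map_mul, mul_inv_cancel, map_one]
    calc ρ (n (1 : Fˣ)) = ρ (n (1 : Fˣ)) * ρ (n (1 : Fˣ)) * ρ (n (1 : Fˣ))⁻¹ := by
          rw [mul_assoc, h2, mul_one]
      _ = 1 := by rw [h1, h2]
  have hm : mult ρ ψ 0 ≠ 0 := by
    rw [mult_ne_zero_iff, h0]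
    exact one_ne_zero
  obtain ⟨v, α, hv⟩ := exists_isBorelEigenvector hm
  refine finrank_eq_one v hv.ne_zero fun w => ?_
  have hw : w ∈ Submodule.span ℂ (Set.range (IsBorelEigenvector.vec ρ v)) := by
    rw [hv.span_vec hρ]; trivial
  have : Set.range (IsBorelEigenvector.vec ρ v) ⊆ {v} := by
    rintro _ ⟨p, rfl⟩
    induction p using OnePoint.rec with
    | infty => rfl
    | coe x =>
      change ρ (u x * n 1) v = v
      rw [map_mul, hu, hn]
      rfl
  exact Submodule.mem_span_singleton.mp (Submodule.span_mono this hw)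

end SL2

namespace SL2

open Matrix

section

variable {F : Type} [Field F] [Fintype F]

variable (F) in
theorem exists_isPrimitive : ∃ ψ : AddChar F ℂ, ψ.IsPrimitive := by
  obtain ⟨ψ, hψ⟩ := AddChar.exists_apply_ne_zero.mpr (one_ne_zero (α := F))
  exact ⟨ψ, AddChar.IsPrimitive.of_ne_one fun h => hψ (by rw [h, AddChar.one_apply])⟩

variable {V : Type} [AddCommGroup V] [Module ℂ V] [FiniteDimensional ℂ V]
  {ρ : Representation ℂ (SpecialLinearGroup (Fin 2) F) V} {ψ : AddChar F ℂ}

theorem finrank_of_mult_eq_one (hψ : ψ.IsPrimitive) (h : ∀ s ≠ 0, mult ρ ψ s = 1) :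
    Module.finrank ℂ V = mult ρ ψ 0 + (Fintype.card F - 1) := by
  classical
  rw [← sum_mult ρ hψ, ← Finset.add_sum_erase _ _ (Finset.mem_univ 0),
    Finset.sum_congr rfl (fun s hs => h s (Finset.ne_of_mem_erase hs))]
  simp [Finset.card_univ]

theorem character_u_of_mult_eq_one (hψ : ψ.IsPrimitive) (h : ∀ s ≠ 0, mult ρ ψ s = 1)
    {x : F} (hx : x ≠ 0) : ρ.character (u x) = mult ρ ψ 0 - 1 := by
  classical
  have h0 := AddChar.sum_mulShift x hψ
  rw [if_neg hx, ← Finset.add_sum_erase _ _ (Finset.mem_univ 0), zero_mul,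
    AddChar.map_zero_eq_one] at h0
  rw [character_u ρ hψ, ← Finset.add_sum_erase _ _ (Finset.mem_univ 0), zero_mul,
    AddChar.map_zero_eq_one, Finset.sum_congr rfl
      (fun s hs => by rw [h s (Finset.ne_of_mem_erase hs), Nat.cast_one, mul_one])]
  linear_combination h0

theorem card_eq_cast : (Nat.card (SpecialLinearGroup (Fin 2) F) : ℂ) =
    (Fintype.card F + 1) * (Fintype.card F * (Fintype.card F - 1)) := by
  rw [card_eq]
  push_cast [Nat.cast_sub Fintype.card_pos]
  ring

omit [Fintype F] in
theorem mul_eq_regChar_of_finrank_eq_one (hd : Module.finrank ℂ V = 1) :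
    ρ.character * regChar _ = regChar _ := by
  ext g
  rw [Pi.mul_apply, regChar]
  split_ifs with h
  · rw [h, Representation.char_one, hd, Nat.cast_one, one_mul]
  · rw [mul_zero]

omit [Fintype F] in
/-- To recognise the regular character as a product, it suffices to look at the identity, at the
upper triangular matrices, and at the elements without fixed points. -/
theorem mul_eq_regChar {φ : SpecialLinearGroup (Fin 2) F → ℂ}
    (hφ : ∀ g k, φ (k * g * k⁻¹) = φ g)
    (h1 : Module.finrank ℂ V * φ 1 = Nat.card (SpecialLinearGroup (Fin 2) F))
    (hB : ∀ a x, t a * u x ≠ (1 : SpecialLinearGroup (Fin 2) F) →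
      ρ.character (t a * u x) * φ (t a * u x) = 0)
    (h0 : ∀ g, fixedPoints g = 0 → ρ.character g * φ g = 0) :
    ρ.character * φ = regChar _ := by
  ext g
  rw [Pi.mul_apply, regChar]
  split_ifs with h
  · rw [h, Representation.char_one, h1]
  by_cases hg : fixedPoints g = 0
  · exact h0 g hg
  · obtain ⟨k, a, x, rfl⟩ := exists_conj_of_fixedPoints_ne_zero hg
    rw [Representation.char_conj, hφ]
    refine hB a x fun h' => h ?_
    rw [h', mul_one, mul_inv_cancel]

variable (F) in
/-- The subgroup of upper unitriangular matrices. -/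
def unipotent : Subgroup (SpecialLinearGroup (Fin 2) F) :=
  (MonoidHom.mk' (fun x : Multiplicative F => u x.toAdd) fun _ _ => u_add _ _).range

omit [Fintype F] in
theorem mem_unipotent {g : SpecialLinearGroup (Fin 2) F} :
    g ∈ unipotent F ↔ ∃ x, u x = g :=
  Iff.rfl

variable (F) in
theorem card_unipotent : Nat.card (unipotent F) = Fintype.card F := by
  rw [← Nat.card_eq_fintype_card]
  refine Nat.card_congr (Equiv.ofInjective (fun x : F => u x) fun x y hxy => ?_).symm
  have := t_mul_u_injective (F := F) (a₁ := (1, x)) (a₂ := (1, y)) (by simpa using hxy)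
  exact (Prod.ext_iff.mp this).2

theorem exists_mul_eq_regChar_of_character_u_eq_zero
    (hd : Module.finrank ℂ V = Fintype.card F) (hu : ∀ x ≠ 0, ρ.character (u x) = 0) :
    ∃ φ, IsVirtualChar _ φ ∧ ρ.character * φ = regChar _ := by
  classical
  refine ⟨_, IsVirtualChar.card_fixedBy (SpecialLinearGroup (Fin 2) F ⧸ unipotent F), ?_⟩
  ext g
  rw [Pi.mul_apply, regChar]
  split_ifs with h
  · have := Subgroup.card_eq_card_quotient_mul_card_subgroup (unipotent F)
    rw [h, Representation.char_one, hd, this, card_unipotent, MulAction.fixedBy_one_eq_univ,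
      Nat.card_univ, Nat.cast_mul, mul_comm]
  · by_cases hg : IsEmpty (MulAction.fixedBy (SpecialLinearGroup (Fin 2) F ⧸ unipotent F) g)
    · rw [Nat.card_of_isEmpty, Nat.cast_zero, mul_zero]
    · obtain ⟨⟨p, hp⟩⟩ := not_isEmpty_iff.mp hg
      induction p using QuotientGroup.induction_on with | H k => ?_
      rw [MulAction.mem_fixedBy, MulAction.Quotient.smul_coe, smul_eq_mul, eq_comm,
        QuotientGroup.eq, mem_unipotent] at hp
      obtain ⟨x, hx⟩ := hp
      have hk : g = k * u x * k⁻¹ := by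
        rw [hx]
        group
      rw [hk, Representation.char_conj, hu x, zero_mul]
      rintro rfl
      exact h (by rw [hk, u_zero, mul_one, mul_inv_cancel])

variable (F) in
theorem isKnutsonType_of_charP_two [CharP F 2] :
    IsKnutsonType (SpecialLinearGroup (Fin 2) F) := by
  classical
  intro χ hχ
  obtain ⟨V, _, _, _, ρ, hρ, rfl⟩ := isIrrChar_iff.mp hχ
  obtain ⟨ψ, hψ⟩ := exists_isPrimitive F
  have hπ := isVirtualChar_fixedPoints (F := F)
  have hconst : ∀ s ≠ 0, mult ρ ψ s = mult ρ ψ 1 := by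
    intro s hs
    obtain ⟨r, hr⟩ := FiniteField.isSquare_of_char_two (ringChar.eq F 2) s
    have hr0 : r ≠ 0 := by
      rintro rfl
      exact hs (by rw [hr, zero_mul])
    rw [hr, ← sq, ← one_mul (r ^ 2)]
    exact mult_mul_sq ρ 1 (Units.mk0 r hr0)
  have hsq : ∀ a : Fˣ, (a : F) ^ 2 = 1 → a = 1 := by
    intro a ha
    ext
    have : ((a : F) - 1) ^ 2 = 0 := by
      rw [sub_sq, ha]
      have h2 : (2 : F) = 0 := CharTwo.two_eq_zero
      linear_combination (1 - (a : F)) * h2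
    exact sub_eq_zero.mp (pow_eq_zero_iff two_ne_zero |>.mp this)
  rcases (mult_le_one hρ hψ one_ne_zero).lt_or_eq with h1 | h1
  · exact ⟨_, IsVirtualChar.regChar, mul_eq_regChar_of_finrank_eq_one
      (finrank_eq_one_of_mult_eq_zero hρ hψ fun s hs => by
        rw [hconst s hs, Nat.lt_one_iff.mp h1])⟩
  have ha : ∀ s ≠ 0, mult ρ ψ s = 1 := fun s hs => by rw [hconst s hs, h1]
  have hd := finrank_of_mult_eq_one hψ ha
  have hq := Fintype.one_lt_card (α := F)
  have hd' : (Module.finrank ℂ V : ℂ) = mult ρ ψ 0 + (Fintype.card F - 1) := by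
    rw [hd]
    push_cast [Nat.cast_sub hq.le]
    ring
  have key (P : ℕ → ℂ) (h1 : Module.finrank ℂ V * P (Fintype.card F + 1) =
      Nat.card (SpecialLinearGroup (Fin 2) F))
      (hT : ∀ (a : Fˣ) (x : F), (a : F) ^ 2 ≠ 1 → ρ.character (t a * u x) * P 2 = 0)
      (hU : ((mult ρ ψ 0 : ℂ) - 1) * P 1 = 0)
      (h0 : ∀ g, fixedPoints g = 0 → ρ.character g * P 0 = 0) :
      (ρ.character * fun g => P (fixedPoints g)) = regChar _ := by
    refine mul_eq_regChar (fun g k => by rw [fixedPoints_conj]) (by rw [fixedPoints_one, h1])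
      (fun a x hax => ?_) fun g hg => by rw [hg, h0 g hg]
    by_cases ha2 : (a : F) ^ 2 = 1
    · have hx : x ≠ 0 := by
        rintro rfl
        exact hax (by rw [hsq a ha2, t_one, u_zero, one_mul])
      rw [fixedPoints_t_mul_u_of_sq_eq ha2 hx, hsq a ha2, t_one, one_mul,
        character_u_of_mult_eq_one hψ ha hx, hU]
    · rw [fixedPoints_t_mul_u_of_sq_ne ha2, hT a x ha2]
  have hb : mult ρ ψ 0 ≤ 2 := by
    by_contra! hb
    obtain ⟨v, α, hv⟩ := exists_isBorelEigenvector (ρ := ρ) (ψ := ψ) (by omega)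
    have := hv.finrank_le hρ
    omega
  interval_cases hm : mult ρ ψ 0
  · refine ⟨_, hπ.mul (hπ.sub IsVirtualChar.one), key (fun k => k * (k - 1)) ?_ ?_ ?_ ?_⟩
    · rw [hd', card_eq_cast]
      push_cast
      ring
    · intro a x ha
      rw [character_t_mul_u_eq_zero ρ ha hm, zero_mul]
    · simp
    · simp
  · refine exists_mul_eq_regChar_of_character_u_eq_zero (by omega) fun x hx => ?_
    rw [character_u_of_mult_eq_one hψ ha hx, hm, Nat.cast_one, sub_self]
  · refine ⟨_, (hπ.sub IsVirtualChar.one).mul (hπ.sub (IsVirtualChar.natCast 2)),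
      key (fun k => (k - 1) * (k - 2)) ?_ ?_ ?_ ?_⟩
    · rw [hd', card_eq_cast]
      push_cast
      ring
    · simp
    · simp
    · intro g hg
      obtain ⟨v, α, hv⟩ := exists_isBorelEigenvector (ρ := ρ) (ψ := ψ) (by omega)
      rw [hv.character_eq_zero hρ (by omega) hg, zero_mul]

end

end SL2

namespace SL2

open Matrix

section

variable {F : Type} [Field F]

theorem t_neg_one_mul_self : t (-1 : Fˣ) * t (-1) = 1 := by
  rw [← t_mul, neg_mul_neg, one_mul, t_one]

theorem t_neg_one_mul (g : SpecialLinearGroup (Fin 2) F) : t (-1) * g = g * t (-1) := by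
  rw [t_neg_one, neg_mul, mul_neg, one_mul, mul_one]

theorem eq_one_or_eq_neg_one {a : Fˣ} (ha : (a : F) ^ 2 = 1) : a = 1 ∨ a = -1 := by
  rw [sq, mul_self_eq_one_iff] at ha
  exact ha.imp (fun h => Units.ext h) fun h => Units.ext h

variable (F) in
theorem exists_anticommute [Finite F] :
    ∃ g : SpecialLinearGroup (Fin 2) F, g * n 1 = t (-1) * (n 1 * g) := by
  obtain ⟨p, hp⟩ := CharP.exists F
  have : NeZero p := ⟨CharP.char_ne_zero_of_finite F p⟩
  obtain ⟨a, b, hab⟩ := CharP.sq_add_sq F p (-1)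
  push_cast at hab
  have hdet : det !![(a : F), b; b, -a] = 1 := by
    rw [det_fin_two_of]
    linear_combination -hab
  obtain ⟨g, hg⟩ : ∃ g : SpecialLinearGroup (Fin 2) F,
      (g : Matrix (Fin 2) (Fin 2) F) = !![(a : F), b; b, -a] := ⟨⟨_, hdet⟩, rfl⟩
  refine ⟨g, ext_coe ?_⟩
  rw [t_neg_one, neg_mul, one_mul]
  simp [coe_n, hg]

variable {V : Type} [AddCommGroup V] [Module ℂ V]
  {ρ : Representation ℂ (SpecialLinearGroup (Fin 2) F) V}

theorem map_t_neg_one (hρ : ρ.IsIrreducible) : ρ (t (-1)) = 1 ∨ ρ (t (-1)) = -1 := by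
  have h1 : ρ (t (-1)) * ρ (t (-1)) = 1 := by rw [← map_mul, t_neg_one_mul_self, map_one]
  rcases hρ.eq_bot_or_eq_top (LinearMap.ker (ρ (t (-1)) - 1)) (fun g v hv => by
    rw [LinearMap.mem_ker, LinearMap.sub_apply, sub_eq_zero] at hv ⊢
    rw [← Module.End.mul_apply, ← map_mul, t_neg_one_mul, map_mul, Module.End.mul_apply, hv]
    rfl) with h | h
  · right
    rw [eq_neg_iff_add_eq_zero]
    have h2 : (ρ (t (-1)) - 1) * (ρ (t (-1)) + 1) = 0 := by
      rw [sub_mul, mul_add, h1, mul_one, one_mul, add_comm, sub_self]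
    ext v
    have h3 : (ρ (t (-1)) + 1) v ∈ LinearMap.ker (ρ (t (-1)) - 1) :=
      congrArg (fun f : Module.End ℂ V => f v) h2
    rw [h, Submodule.mem_bot] at h3
    exact h3
  · left
    rw [LinearMap.ker_eq_top, sub_eq_zero] at h
    exact h

theorem character_t_neg_one_mul_of_eq_neg_one (h : ρ (t (-1)) = -1)
    (g : SpecialLinearGroup (Fin 2) F) : ρ.character (t (-1) * g) = -ρ.character g := by
  rw [Representation.character, map_mul, h, neg_mul, one_mul, map_neg]
  rfl

theorem character_n_one_eq_zero [Finite F] (h : ρ (t (-1)) = -1) : ρ.character (n 1) = 0 := by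
  obtain ⟨g, hg⟩ := exists_anticommute F
  have h1 : g * n 1 * g⁻¹ = t (-1) * n 1 := by rw [hg]; group
  have h2 := Representation.char_conj ρ (n 1) g
  rw [h1, character_t_neg_one_mul_of_eq_neg_one h] at h2
  exact self_eq_neg.mp h2.symm

theorem even_finrank [Finite F] [FiniteDimensional ℂ V] (h : ρ (t (-1)) = -1) :
    Even (Module.finrank ℂ V) := by
  obtain ⟨g, hg⟩ := exists_anticommute F
  have h1 := congrArg (fun k => LinearMap.det (ρ k)) hg
  have hdet : ∀ k, LinearMap.det (ρ k) ≠ 0 := fun k hk => by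
    have := congrArg LinearMap.det (map_mul ρ k k⁻¹)
    rw [mul_inv_cancel, map_one, map_one, map_mul, hk, zero_mul] at this
    exact one_ne_zero this
  simp only [map_mul, h] at h1
  rw [mul_comm (LinearMap.det (ρ g)), eq_comm] at h1
  have h2 := mul_right_cancel₀ (mul_ne_zero (hdet _) (hdet _)) (h1.trans (one_mul _).symm)
  rw [← neg_one_smul ℂ (1 : Module.End ℂ V), LinearMap.det_smul, map_one, mul_one] at h2
  by_contra hodd
  rw [Nat.not_even_iff_odd] at hodd
  rw [hodd.neg_one_pow] at h2
  norm_num at h2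

end

section CardEqThree

variable {F : Type} [Field F] [Fintype F]

theorem sq_eq_one_of_card_eq_three (hF : Fintype.card F = 3) (a : Fˣ) : (a : F) ^ 2 = 1 := by
  have := FiniteField.pow_card_sub_one_eq_one (a : F) a.ne_zero
  rwa [hF] at this

theorem three_eq_zero_of_card_eq_three (hF : Fintype.card F = 3) : (3 : F) = 0 := by
  have := FiniteField.cast_card_eq_zero F
  rw [hF] at this
  exact_mod_cast this

theorem fixedPoints_n_mul_u_ne_zero (hF : Fintype.card F = 3) (c z : Fˣ) :
    fixedPoints (n c * u (z : F)) ≠ 0 := by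
  classical
  have h3 := three_eq_zero_of_card_eq_three hF
  have hc := sq_eq_one_of_card_eq_three hF c
  have hz := sq_eq_one_of_card_eq_three hF z
  have : Finite (OnePoint F) := inferInstanceAs (Finite (Option F))
  rw [fixedPoints, Nat.card_ne_zero]
  refine ⟨⟨⟨((z : F) : OnePoint F), ?_⟩⟩, Subtype.finite⟩
  have hcz : (c : F) * (z + z) ≠ 0 := by
    refine mul_ne_zero c.ne_zero fun h => z.ne_zero ?_
    linear_combination (z : F) * h3 - h
  have h10 : (n c * u (z : F)) 1 0 * z + (n c * u (z : F)) 1 1 = c * (z + z) := by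
    simp [coe_n, coe_u, mul_add]
  have h00 : (n c * u (z : F)) 0 0 * z + (n c * u (z : F)) 0 1 = -(c : F)⁻¹ := by
    simp [coe_n, coe_u]
  rw [MulAction.mem_fixedBy, smul_coe, h10, h00, if_neg hcz]
  congr 1
  rw [div_eq_iff hcz, ← mul_right_inj' c.ne_zero, mul_neg, mul_inv_cancel₀ c.ne_zero]
  linear_combination -2 * (c : F) ^ 2 * hz - 2 * hc - h3

variable {V : Type} [AddCommGroup V] [Module ℂ V] [FiniteDimensional ℂ V]
  {ρ : Representation ℂ (SpecialLinearGroup (Fin 2) F) V} {ψ : AddChar F ℂ}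

omit [FiniteDimensional ℂ V] in
theorem character_eq_zero_of_card_eq_three (hF : Fintype.card F = 3) (h : ρ (t (-1)) = -1)
    {g : SpecialLinearGroup (Fin 2) F} (hg : fixedPoints g = 0) : ρ.character g = 0 := by
  rcases bruhat g with ⟨a, x, rfl⟩ | ⟨x, c, y, rfl⟩
  · exfalso
    by_cases hx : x = 0
    · rw [hx, u_zero, mul_one, fixedPoints_t_of_sq_eq (sq_eq_one_of_card_eq_three hF a)] at hg
      omega
    · rw [fixedPoints_t_mul_u_of_sq_eq (sq_eq_one_of_card_eq_three hF a) hx] at hg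
      omega
  · have h1 : u x * n c * u y = u x * (n c * u (y + x)) * (u x)⁻¹ := by
      rw [u_add]
      group
    rw [h1, fixedPoints_conj] at hg
    rw [h1, Representation.char_conj]
    have hz : y + x = 0 := by
      by_contra hz
      exact fixedPoints_n_mul_u_ne_zero hF c (Units.mk0 _ hz) hg
    rw [hz, u_zero, mul_one]
    rcases eq_one_or_eq_neg_one (sq_eq_one_of_card_eq_three hF c) with rfl | rfl
    · exact character_n_one_eq_zero h
    · have : n (-1 : Fˣ) = t (-1) * n 1 := by
        rw [t_mul_n, one_mul, inv_neg, inv_one]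
      rw [this, character_t_neg_one_mul_of_eq_neg_one h, character_n_one_eq_zero h, neg_zero]

omit [FiniteDimensional ℂ V] in
theorem map_t_of_card_eq_three (hF : Fintype.card F = 3) (hρ : ρ.IsIrreducible) (a : Fˣ) :
    ρ (t a) = 1 ∨ ρ (t a) = -1 := by
  rcases eq_one_or_eq_neg_one (sq_eq_one_of_card_eq_three hF a) with rfl | rfl
  · left
    rw [t_one, map_one]
  · exact map_t_neg_one hρ

theorem mult_zero_le_one_of_card_eq_three (hF : Fintype.card F = 3) (hρ : ρ.IsIrreducible) :
    mult ρ ψ 0 ≤ 1 := by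
  have hU : ∀ x, ρ (u x) * proj ρ ψ 0 = proj ρ ψ 0 := fun x => by
    rw [map_u_mul_proj, zero_mul, AddChar.map_zero_eq_one, one_smul]
  have hU' : ∀ x, proj ρ ψ 0 * ρ (u x) = proj ρ ψ 0 := fun x => by
    rw [← commute_map_u_proj, hU]
  have hE := proj_mul_proj_self (ψ := ψ) ρ 0
  have key : ∀ g, ∃ c : ℂ, proj ρ ψ 0 * ρ g * proj ρ ψ 0 = c • proj ρ ψ 0 ∨
      proj ρ ψ 0 * ρ g * proj ρ ψ 0 = c • (proj ρ ψ 0 * ρ (n 1) * proj ρ ψ 0) := by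
    intro g
    rcases bruhat g with ⟨a, x, rfl⟩ | ⟨x, c, y, rfl⟩
    · rw [map_mul, mul_assoc, mul_assoc, hU]
      rcases map_t_of_card_eq_three hF hρ a with h | h
      · exact ⟨1, Or.inl (by rw [h, one_mul, hE, one_smul])⟩
      · exact ⟨-1, Or.inl (by rw [h, neg_one_mul, mul_neg, hE, neg_one_smul])⟩
    · have hc : n c = n 1 * t c := by rw [n_mul_t, one_mul]
      rw [map_mul, map_mul, ← mul_assoc, ← mul_assoc, hU', mul_assoc, hU, hc, map_mul]
      rcases map_t_of_card_eq_three hF hρ c with h | h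
      · exact ⟨1, Or.inr (by rw [h, mul_one, one_smul])⟩
      · exact ⟨-1, Or.inr (by rw [h, mul_neg_one, mul_neg, neg_mul, neg_one_smul])⟩
  have hassoc (a b : Module.End ℂ V) : proj ρ ψ 0 * a * proj ρ ψ 0 * b * proj ρ ψ 0 =
      (proj ρ ψ 0 * a * proj ρ ψ 0) * (proj ρ ψ 0 * b * proj ρ ψ 0) := by
    conv_lhs => rw [← hE]
    simp only [mul_assoc]
    simp only [← mul_assoc, hE]
  refine hρ.finrank_range_le_one hE fun g k => ?_
  rw [hassoc, hassoc]
  set W := proj ρ ψ 0 * ρ (n 1) * proj ρ ψ 0 with hW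
  have h1 : proj ρ ψ 0 * W = W := by rw [hW, ← mul_assoc, ← mul_assoc, hE]
  have h2 : W * proj ρ ψ 0 = W := by rw [hW, mul_assoc, hE]
  obtain ⟨c, hc | hc⟩ := key g <;> obtain ⟨d, hd | hd⟩ := key k <;>
    rw [hc, hd] <;>
    simp only [smul_mul_smul_comm, h1, h2, mul_comm c d]

/-- A two-dimensional representation on which `-1` acts trivially is reducible. -/
theorem finrank_ne_two_of_card_eq_three (hF : Fintype.card F = 3) (hρ : ρ.IsIrreducible)
    (h : ρ (t (-1)) = 1) : Module.finrank ℂ V ≠ 2 := by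
  intro hd
  have h3 := three_eq_zero_of_card_eq_three hF
  have ht : ∀ a, ρ (t a) = 1 := fun a => by
    rcases eq_one_or_eq_neg_one (sq_eq_one_of_card_eq_three hF a) with rfl | rfl
    · rw [t_one, map_one]
    · exact h
  have hn : ∀ c, ρ (n c) = ρ (n 1) := fun c => by
    rw [show n c = n 1 * t c by rw [n_mul_t, one_mul], map_mul, ht, mul_one]
  have hu : u (1 : F) * u 1 * u 1 = 1 := by
    rw [← u_add, ← u_add, show (1 : F) + 1 + 1 = 0 by linear_combination h3, u_zero]
  have hu' : u (-1 : F) * u 1 = 1 := by rw [← u_add, neg_add_cancel, u_zero]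
  have hww : ρ (n 1) * ρ (n 1) = 1 := by rw [← map_mul, n_mul_n, ht]
  have hdet : LinearMap.det (ρ (n 1)) = 1 := by
    have e1 := congrArg (fun k => LinearMap.det (ρ k)) (n_mul_u_mul_n (1 : Fˣ) 1 1)
    have e2 := congrArg (fun k => LinearMap.det (ρ k)) hu
    have e3 := congrArg (fun k => LinearMap.det (ρ k)) hu'
    have e4 := congrArg LinearMap.det hww
    simp only [map_mul, map_one, Units.val_one, one_pow, mul_one, inv_one] at e1 e2 e3 e4
    generalize LinearMap.det (ρ (n 1)) = x at *
    generalize LinearMap.det (ρ (u 1)) = y at *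
    generalize LinearMap.det (ρ (u (-1))) = z at *
    have : x * (y * y * y) = 1 := by
      calc x * (y * y * y) = (x * y * x) * (x * y * y) := by
            linear_combination (-x * y * y * y) * e4
        _ = 1 := by rw [e1]; linear_combination (y * z + 1) * e3 + (y * z) ^ 2 * e4
    rwa [e2, mul_one] at this
  let b := Module.finBasisOfFinrankEq ℂ V hd
  set M := LinearMap.toMatrix b b (ρ (n 1)) with hM
  have hM1 : M * M = 1 := by
    rw [hM, ← LinearMap.toMatrix_mul, hww, LinearMap.toMatrix_one]
  have hM2 : M.adjugate = M := by
    calc M.adjugate = M * M * M.adjugate := by rw [hM1, one_mul]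
      _ = M := by rw [mul_assoc, mul_adjugate, hM, LinearMap.det_toMatrix, hdet, one_smul, mul_one]
  have hscalar : ∀ v, ρ (n 1) v = M 0 0 • v := by
    rw [adjugate_fin_two] at hM2
    have e00 := congrFun (congrFun hM2 0) 0
    have e01 := congrFun (congrFun hM2 0) 1
    have e10 := congrFun (congrFun hM2 1) 0
    simp only [of_apply, cons_val', cons_val_zero, cons_val_one, cons_val_fin_one] at e00 e01 e10
    have : M = M 0 0 • (1 : Matrix (Fin 2) (Fin 2) ℂ) := by
      ext i j
      fin_cases i <;> fin_cases j
      · simp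
      · simpa using neg_eq_self.mp e01
      · simpa using neg_eq_self.mp e10
      · simpa using e00
    intro v
    have h' : ρ (n 1) = M 0 0 • (1 : Module.End ℂ V) := by
      apply (LinearMap.toMatrix b b).injective
      rw [map_smul, LinearMap.toMatrix_one, ← hM]
      exact this
    rw [h']
    rfl
  have := hρ.nontrivial
  obtain ⟨v, -, hv0, μ, hμ⟩ := Module.End.exists_eigenvector_mem (W := (⊤ : Submodule ℂ V))
    top_ne_bot (ρ (u 1)) fun _ _ => trivial
  have hu3 : ∀ x : F, ∃ c : ℂ, ρ (u x) v = c • v := by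
    intro x
    by_cases hx : x = 0
    · exact ⟨1, by rw [hx, u_zero, map_one, one_smul]; rfl⟩
    · rcases eq_one_or_eq_neg_one (sq_eq_one_of_card_eq_three hF (Units.mk0 x hx)) with h | h
      · have hx1 : x = 1 := congrArg Units.val h
        exact ⟨μ, by rw [hx1, hμ]⟩
      · have hx1 : x = 1 + 1 := by
          have : x = -1 := congrArg Units.val h
          linear_combination this - h3
        exact ⟨μ * μ, by rw [hx1, u_add, map_mul, Module.End.mul_apply, hμ, map_smul, hμ,
          smul_smul]⟩
  have hall : ∀ g, ∃ c : ℂ, ρ g v = c • v := by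
    intro g
    rcases bruhat g with ⟨a, x, rfl⟩ | ⟨x, c, y, rfl⟩
    · rw [map_mul, ht, one_mul]
      exact hu3 x
    · obtain ⟨c₁, h₁⟩ := hu3 x
      obtain ⟨c₂, h₂⟩ := hu3 y
      exact ⟨c₂ * (M 0 0 * c₁), by
        rw [map_mul, map_mul, hn, Module.End.mul_apply, Module.End.mul_apply, h₂, map_smul, hscalar,
          map_smul, map_smul, h₁, smul_smul, smul_smul, mul_assoc]⟩
  have h1 : Module.finrank ℂ V = 1 := by
    refine finrank_eq_one v hv0 fun w => ?_
    have hw : w ∈ Submodule.span ℂ (Set.range fun g => ρ g v) := by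
      rw [hρ.span_orbit hv0]
      trivial
    have hle : Submodule.span ℂ (Set.range fun g => ρ g v) ≤ Submodule.span ℂ {v} := by
      rw [Submodule.span_le]
      rintro _ ⟨g, rfl⟩
      obtain ⟨c, hc⟩ := hall g
      exact Submodule.mem_span_singleton.mpr ⟨c, hc.symm⟩
    exact Submodule.mem_span_singleton.mp (hle hw)
  omega

theorem isKnutsonType_of_card_eq_three (hF : Fintype.card F = 3) :
    IsKnutsonType (SpecialLinearGroup (Fin 2) F) := by
  classical
  intro χ hχ
  have hχ' := IsVirtualChar.of_isIrrChar hχ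
  obtain ⟨V, _, _, _, ρ, hρ, rfl⟩ := isIrrChar_iff.mp hχ
  obtain ⟨ψ, hψ⟩ := exists_isPrimitive F
  have hπ := isVirtualChar_fixedPoints (F := F)
  have h0 := mult_zero_le_one_of_card_eq_three (ψ := ψ) hF hρ
  have h1 := fun s hs => mult_le_one (s := s) hρ hψ hs
  have hV := hρ.nontrivial
  have hpos : 0 < Module.finrank ℂ V := Module.finrank_pos
  have hsum := sum_mult ρ hψ
  have huniv : (Finset.univ : Finset F).erase 0 = {1, -1} := by
    ext x
    simp only [Finset.mem_erase, Finset.mem_univ, and_true, Finset.mem_insert,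
      Finset.mem_singleton]
    constructor
    · intro hx
      exact (eq_one_or_eq_neg_one (sq_eq_one_of_card_eq_three hF (Units.mk0 x hx))).imp
        (congrArg Units.val) (congrArg Units.val)
    · rintro (rfl | rfl) <;> simp
  have hne : (1 : F) ≠ -1 := by
    intro h
    apply one_ne_zero (α := F)
    linear_combination three_eq_zero_of_card_eq_three hF - h
  rw [← Finset.add_sum_erase _ _ (Finset.mem_univ 0), huniv, Finset.sum_pair hne] at hsum
  have ha := h1 1 one_ne_zero
  have hb := h1 (-1) (neg_ne_zero.mpr one_ne_zero)
  obtain hd | hd | hd : Module.finrank ℂ V = 1 ∨ Module.finrank ℂ V = 2 ∨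
    Module.finrank ℂ V = 3 := by omega
  · exact ⟨_, IsVirtualChar.regChar, mul_eq_regChar_of_finrank_eq_one hd⟩
  · have hneg := (map_t_neg_one hρ).resolve_left
      fun h => finrank_ne_two_of_card_eq_three hF hρ h hd
    refine ⟨_, ((hπ.sub IsVirtualChar.one).mul (hπ.sub (IsVirtualChar.natCast 2))).add
      ((hχ'.mul (hπ.sub IsVirtualChar.one)).mul (hπ.sub (IsVirtualChar.natCast 3))),
      mul_eq_regChar (fun g k => ?_) ?_ (fun a x hax => ?_) fun g hg => ?_⟩
    · simp only [Pi.add_apply, Pi.mul_apply, Pi.sub_apply, fixedPoints_conj,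
        Representation.char_conj]
      rfl
    · simp only [Pi.add_apply, Pi.mul_apply, Pi.sub_apply, fixedPoints_one, hd, hF,
        Representation.char_one, card_eq_cast, Pi.one_apply]
      norm_num
    · by_cases hx : x = 0
      · subst hx
        rw [u_zero, mul_one] at hax ⊢
        have : a = -1 :=
          (eq_one_or_eq_neg_one (sq_eq_one_of_card_eq_three hF a)).resolve_left
            fun h => hax (by rw [h, t_one])
        subst this
        have hχ1 : ρ.character (t (-1)) = -2 := by
          have := character_t_neg_one_mul_of_eq_neg_one hneg 1
          rwa [mul_one, Representation.char_one, hd, Nat.cast_ofNat] at this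
        simp only [Pi.add_apply, Pi.mul_apply, Pi.sub_apply, hχ1, hF,
          fixedPoints_t_of_sq_eq (sq_eq_one_of_card_eq_three hF _), Pi.one_apply]
        norm_num
      · simp [fixedPoints_t_mul_u_of_sq_eq (sq_eq_one_of_card_eq_three hF a) hx]
    · rw [character_eq_zero_of_card_eq_three hF hneg hg, zero_mul]
  · have hall : ∀ s ≠ 0, mult ρ ψ s = 1 := by
      intro s hs
      have : s ∈ ({1, -1} : Finset F) := by
        rw [← huniv]
        exact Finset.mem_erase.mpr ⟨hs, Finset.mem_univ _⟩
      rw [Finset.mem_insert, Finset.mem_singleton] at this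
      rcases this with rfl | rfl <;> omega
    refine exists_mul_eq_regChar_of_character_u_eq_zero (hd.trans hF.symm) fun x hx => ?_
    rw [character_u_of_mult_eq_one hψ hall hx, show mult ρ ψ 0 = 1 by omega, Nat.cast_one,
      sub_self]

end CardEqThree

end SL2

namespace SL2

open Matrix

variable {F : Type} [Field F] [Fintype F]

theorem exists_sub_eq_four_mul {φ : SpecialLinearGroup (Fin 2) F → ℂ}
    (hφ : IsVirtualChar _ φ) : ∃ k : ℤ, φ 1 - φ (t (-1)) = 4 * k := by
  classical
  unfold IsVirtualChar at hφ
  induction hφ using Submodule.span_induction with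
  | mem χ hχ =>
    obtain ⟨V, _, _, _, ρ, hρ, rfl⟩ := isIrrChar_iff.mp hχ
    rcases map_t_neg_one hρ with h | h
    · refine ⟨0, ?_⟩
      rw [Representation.character, Representation.character, map_one, h]
      simp
    · obtain ⟨m, hm⟩ := even_finrank h
      refine ⟨m, ?_⟩
      have := character_t_neg_one_mul_of_eq_neg_one h 1
      rw [mul_one] at this
      rw [this, Representation.char_one, hm]
      push_cast
      ring
  | zero => exact ⟨0, by simp⟩
  | add f g _ _ hf hg =>
    obtain ⟨k, hk⟩ := hf
    obtain ⟨l, hl⟩ := hg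
    refine ⟨k + l, ?_⟩
    rw [Pi.add_apply, Pi.add_apply]
    push_cast
    linear_combination hk + hl
  | smul a f _ hf =>
    obtain ⟨k, hk⟩ := hf
    refine ⟨a * k, ?_⟩
    rw [Pi.smul_apply, Pi.smul_apply, zsmul_eq_mul, zsmul_eq_mul]
    push_cast
    linear_combination a * hk

/-- In odd characteristic, the virtual characters vanishing at `-1` have degree divisible by `4`,
which restricts the degrees of the regular invertible characters. -/
theorem four_mul_finrank_dvd_card (h2 : ringChar F ≠ 2)
    (hK : IsKnutsonType (SpecialLinearGroup (Fin 2) F)) {V : Type} [AddCommGroup V] [Module ℂ V]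
    [FiniteDimensional ℂ V] {ρ : Representation ℂ (SpecialLinearGroup (Fin 2) F) V}
    (hρ : ρ.IsIrreducible) :
    4 * Module.finrank ℂ V ∣ Nat.card (SpecialLinearGroup (Fin 2) F) := by
  classical
  obtain ⟨φ, hφ, hφρ⟩ := hK ρ.character (isIrrChar_iff.mpr ⟨V, _, _, inferInstance, ρ, hρ, rfl⟩)
  obtain ⟨k, hk⟩ := exists_sub_eq_four_mul hφ
  have hV := hρ.nontrivial
  have hd : (Module.finrank ℂ V : ℂ) ≠ 0 := Nat.cast_ne_zero.mpr Module.finrank_pos.ne'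
  have hne : t (-1 : Fˣ) ≠ (1 : SpecialLinearGroup (Fin 2) F) := by
    intro h
    have := congrArg (fun g : SpecialLinearGroup (Fin 2) F => g 0 0) h
    simp only [coe_t] at this
    exact Ring.neg_one_ne_one_of_char_ne_two h2 (by simpa using this)
  have h1 := congrFun hφρ 1
  have h3 := congrFun hφρ (t (-1))
  rw [Pi.mul_apply, regChar, if_pos rfl, Representation.char_one] at h1
  rw [Pi.mul_apply, regChar, if_neg hne] at h3
  have hχ : ρ.character (t (-1)) ≠ 0 := by
    rw [Representation.character]
    rcases map_t_neg_one hρ with h | h <;> rw [h]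
    · simpa using hd
    · simpa using hd
  have h4 := (mul_eq_zero.mp h3).resolve_left hχ
  rw [h4, sub_zero] at hk
  rw [hk] at h1
  rw [← Int.natCast_dvd_natCast]
  refine ⟨k, ?_⟩
  have : ((Nat.card (SpecialLinearGroup (Fin 2) F) : ℤ) : ℂ) =
      (((4 * Module.finrank ℂ V : ℕ) : ℤ) * k : ℤ) := by
    push_cast
    rw [← h1]
    ring
  exact_mod_cast this

open scoped Classical in
theorem sum_eq_add_sum_units {M : Type*} [AddCommMonoid M] (f : F → M) :
    ∑ x, f x = f 0 + ∑ x : Fˣ, f x := by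
  rw [Fintype.sum_eq_add_sum_subtype_ne f 0]
  congr 1
  exact (Fintype.sum_equiv unitsEquivNeZero _ _ fun x => rfl).symm

theorem exists_sq_ne_one (hF : 3 < Fintype.card F) : ∃ a : Fˣ, a ^ 2 ≠ 1 := by
  classical
  by_contra! h
  have hsub : (Finset.univ : Finset Fˣ) ⊆ {1, -1} := fun a _ => by
    have := eq_one_or_eq_neg_one (a := a) (by rw [← Units.val_pow_eq_pow_val, h a, Units.val_one])
    simpa using this
  have := (Finset.card_le_card hsub).trans Finset.card_le_two
  rw [Finset.card_univ, Fintype.card_units] at this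
  omega

theorem exists_irreducible_isBorelEigenvector (α : Fˣ →* ℂˣ) :
    ∃ (V : Type) (_ : AddCommGroup V) (_ : Module ℂ V) (_ : FiniteDimensional ℂ V)
      (ρ : Representation ℂ (SpecialLinearGroup (Fin 2) F) V), ρ.IsIrreducible ∧
      ∃ v, IsBorelEigenvector ρ v fun a => (α a : ℂ) := by
  classical
  obtain ⟨V, _, _, _, ρ, hρ, hX⟩ := exists_irreducible_sum_ne_zero
    (fun p : Fˣ × F => t p.1 * u p.2) t_mul_u_injective
    (fun p => ((α p.1)⁻¹ : ℂˣ)) (fun h => (α 1)⁻¹.ne_zero (congrFun h (1, 0)))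
  refine ⟨V, _, _, inferInstance, ρ, hρ, ?_⟩
  obtain ⟨w, hw⟩ := DFunLike.ne_iff.mp hX
  refine ⟨_, hw, fun y => ?_, fun b => ?_⟩
  · simp only [LinearMap.sum_apply, LinearMap.smul_apply, map_sum, map_smul,
      Fintype.sum_prod_type]
    refine Finset.sum_congr rfl fun a _ => ?_
    refine Fintype.sum_equiv (Equiv.addLeft (((a⁻¹ : Fˣ) : F) ^ 2 * y)) _ _ fun x => ?_
    rw [← Module.End.mul_apply, ← map_mul, ← mul_assoc, Equiv.coe_addLeft, u_add, ← mul_assoc,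
      t_mul_u a, ← mul_assoc, ← mul_pow, Units.mul_inv, one_pow, one_mul]
  · simp only [LinearMap.sum_apply, LinearMap.smul_apply, map_sum, map_smul,
      Fintype.sum_prod_type]
    rw [Finset.smul_sum]
    refine Fintype.sum_equiv (Equiv.mulLeft b) _ _ fun a => ?_
    rw [Finset.smul_sum]
    refine Finset.sum_congr rfl fun x _ => ?_
    rw [← Module.End.mul_apply, ← map_mul, ← mul_assoc, Equiv.coe_mulLeft, ← t_mul, smul_smul,
      ← Units.val_mul, map_mul α, mul_inv, mul_inv_cancel_left]

section

variable {V : Type} [AddCommGroup V] [Module ℂ V] [FiniteDimensional ℂ V]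
  {ρ : Representation ℂ (SpecialLinearGroup (Fin 2) F) V} {v : V} {α : Fˣ →* ℂˣ}

omit [FiniteDimensional ℂ V] in
theorem IsBorelEigenvector.map_t_proj_zero (h : IsBorelEigenvector ρ v fun a => (α a : ℂ))
    (ψ : AddChar F ℂ) (a : Fˣ) :
    ρ (t a) (proj ρ ψ 0 (ρ (n 1) v)) = ((α a)⁻¹ : ℂˣ) • proj ρ ψ 0 (ρ (n 1) v) := by
  have h1 := congrArg (fun f : Module.End ℂ V => f (ρ (n 1) v)) (map_t_mul_proj ρ ψ a 0)
  simp only [Module.End.mul_apply, zero_mul] at h1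
  rw [h1, ← Module.End.mul_apply (ρ (t a)), ← map_mul, t_mul_n, ← n_mul_t, map_mul,
    Module.End.mul_apply, h.map_t, map_smul, map_smul, map_inv]
  rfl

open scoped Classical in
omit [FiniteDimensional ℂ V] in
theorem IsBorelEigenvector.proj_zero_map_n (h : IsBorelEigenvector ρ v fun a => (α a : ℂ))
    (ψ : AddChar F ℂ) (s : F) :
    proj ρ ψ 0 (ρ (n 1) (proj ρ ψ s (ρ (n 1) v))) = (Fintype.card F : ℂ)⁻¹ • ((α (-1) : ℂ) • v +
      (∑ x : Fˣ, ψ (-(s * x)) * α x) • proj ρ ψ 0 (ρ (n 1) v)) := by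
  have hE : proj ρ ψ 0 v = v := proj_zero_apply_of_forall ρ ψ h.map_u
  have hU : ∀ x w, proj ρ ψ 0 (ρ (u x) w) = proj ρ ψ 0 w := fun x w => by
    rw [← Module.End.mul_apply, proj_mul_map_u, zero_mul, AddChar.map_zero_eq_one, one_smul]
  conv_lhs => enter [2, 2]; rw [proj]
  simp only [LinearMap.smul_apply, LinearMap.sum_apply, map_smul, map_sum]
  congr 1
  rw [sum_eq_add_sum_units, Finset.sum_smul]
  congr 1
  · rw [mul_zero, neg_zero, AddChar.map_zero_eq_one, one_smul, u_zero, map_one,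
      Module.End.one_apply, ← Module.End.mul_apply (ρ (n 1)), ← map_mul, n_mul_n, inv_one, mul_one,
      h.map_t, map_smul, hE]
  · refine Finset.sum_congr rfl fun x _ => ?_
    rw [← Module.End.mul_apply (ρ (u _)), ← map_mul, ← Module.End.mul_apply (ρ (n 1)), ← map_mul,
      ← mul_assoc, n_mul_u_mul_n, h.map_u_mul_n_mul_u, map_smul, map_mul ρ,
      Module.End.mul_apply, hU, smul_smul, one_mul, mul_one]

theorem IsBorelEigenvector.finrank_eq (h : IsBorelEigenvector ρ v fun a => (α a : ℂ))
    (hρ : ρ.IsIrreducible) {a : Fˣ} (ha : α a ^ 2 ≠ 1) :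
    Module.finrank ℂ V = Fintype.card F + 1 := by
  classical
  obtain ⟨ψ, hψ⟩ := exists_isPrimitive F
  refine le_antisymm (h.finrank_le hρ) ?_
  set z := proj ρ ψ 0 (ρ (n 1) v) with hz
  have hza := h.map_t_proj_zero ψ a
  rw [← hz, Units.smul_def] at hza
  have hne : (α a : ℂ) - ((α a)⁻¹ : ℂˣ) ≠ 0 := by
    rw [sub_ne_zero]
    intro h'
    apply ha
    rw [sq, ← eq_inv_iff_mul_eq_one]
    exact Units.ext h'
  have hproj : ∀ s, proj ρ ψ s (ρ (n 1) v) ≠ 0 := by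
    intro s hs
    have h1 := h.proj_zero_map_n ψ s
    rw [hs, map_zero, map_zero, eq_comm, smul_eq_zero] at h1
    replace h1 := h1.resolve_left (inv_ne_zero (Nat.cast_ne_zero.mpr Fintype.card_ne_zero))
    rw [← hz] at h1
    have h2 := congrArg (ρ (t a)) h1
    rw [map_add, map_smul, map_smul, hza, h.map_t, map_zero] at h2
    have h3 : ((α (-1) : ℂ) * ((α a : ℂ) - ((α a)⁻¹ : ℂˣ))) • v = 0 := by
      linear_combination (norm := module) h2 - (((α a)⁻¹ : ℂˣ) : ℂ) • h1
    exact (smul_ne_zero (mul_ne_zero (α (-1)).ne_zero hne) h.ne_zero) h3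
  have hs : ∀ s, 1 ≤ mult ρ ψ s := fun s => by
    rw [Nat.one_le_iff_ne_zero, mult_ne_zero_iff]
    intro h'
    exact hproj s (by rw [h']; rfl)
  have h0 : mult ρ ψ 0 ≠ 1 := by
    intro h0
    have hv0 : v ∈ LinearMap.range (proj ρ ψ 0) := ⟨v, proj_zero_apply_of_forall ρ ψ h.map_u⟩
    obtain ⟨c, hc⟩ := (finrank_eq_one_iff_of_nonzero' (⟨v, hv0⟩ : LinearMap.range (proj ρ ψ 0))
      (fun h' => h.ne_zero (congrArg Subtype.val h'))).mp h0 ⟨z, ⟨_, rfl⟩⟩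
    replace hc : c • v = z := congrArg Subtype.val hc
    have h1 : ρ (t a) z = (α a : ℂ) • z := by
      rw [← hc, map_smul, h.map_t, smul_comm]
    have h2 : ((α a : ℂ) - ((α a)⁻¹ : ℂˣ)) • z = 0 := by
      rw [sub_smul, ← h1, hza, sub_self]
    exact smul_ne_zero hne (hproj 0) h2
  rw [← sum_mult ρ hψ, ← Finset.add_sum_erase _ _ (Finset.mem_univ 0)]
  have h1 := Finset.card_nsmul_le_sum (Finset.univ.erase (0 : F)) (mult ρ ψ) 1 fun s _ => hs s
  change _ ≤ ∑ s ∈ _, _ at h1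
  rw [Finset.card_erase_of_mem (Finset.mem_univ _), Finset.card_univ, smul_eq_mul, mul_one] at h1
  have := hs 0
  omega

end

variable (F) in
theorem exists_irreducible_finrank_eq_card_add_one (hF : 3 < Fintype.card F) :
    ∃ (V : Type) (_ : AddCommGroup V) (_ : Module ℂ V) (_ : FiniteDimensional ℂ V)
      (ρ : Representation ℂ (SpecialLinearGroup (Fin 2) F) V), ρ.IsIrreducible ∧
      Module.finrank ℂ V = Fintype.card F + 1 := by
  obtain ⟨a, ha⟩ := exists_sq_ne_one hF
  obtain ⟨α, hα⟩ := CommGroup.exists_apply_ne_one_of_hasEnoughRootsOfUnity Fˣ ℂ ha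
  rw [map_pow] at hα
  obtain ⟨V, _, _, _, ρ, hρ, v, hv⟩ := exists_irreducible_isBorelEigenvector α
  exact ⟨V, _, _, inferInstance, ρ, hρ, hv.finrank_eq hρ hα⟩

end SL2

namespace SL2

open Matrix

variable {F : Type} [Field F] [Fintype F]

open scoped Classical in
/-- A discrete analogue of the Bessel transform. -/
noncomputable def bessel (ψ : AddChar F ℂ) (δ : F) : (Fˣ → ℂ) →ₗ[ℂ] Fˣ → ℂ where
  toFun h y := ∑ t : Fˣ, h t * ψ (-(δ * (y * (t : F)⁻¹)) + -((t : F) * y)⁻¹)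
  map_add' h k := by
    ext y
    simp only [Pi.add_apply, add_mul, Finset.sum_add_distrib]
  map_smul' c h := by
    ext y
    simp only [Pi.smul_apply, smul_eq_mul, mul_assoc, Finset.mul_sum, RingHom.id_apply]

open scoped Classical in
theorem bessel_apply (ψ : AddChar F ℂ) (δ : F) (h : Fˣ → ℂ) (y : Fˣ) :
    bessel ψ δ h y = ∑ t : Fˣ, h t * ψ (-(δ * (y * (t : F)⁻¹)) + -((t : F) * y)⁻¹) :=
  rfl

theorem exists_bessel_eq_zero (ψ : AddChar F ℂ) {δ : Fˣ} (hδ : δ ≠ 1) :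
    ∃ h ≠ 0, bessel ψ (δ : F) h = 0 := by
  classical
  by_contra! hcon
  have hinj : Function.Injective (bessel ψ (δ : F)) := by
    rw [← LinearMap.ker_eq_bot, LinearMap.ker_eq_bot']
    intro h hh
    by_contra h0
    exact hcon h h0 hh
  obtain ⟨h, hh⟩ := LinearMap.injective_iff_surjective.mp hinj (Pi.single 1 1)
  have h1 : bessel ψ (δ : F) h 1 = bessel ψ (δ : F) h δ⁻¹ := by
    rw [bessel_apply, bessel_apply]
    refine Finset.sum_congr rfl fun t _ => ?_
    congr 2
    have := δ.ne_zero
    have := t.ne_zero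
    rw [Units.val_inv_eq_inv_val, Units.val_one]
    field_simp
    ring
  rw [hh, Pi.single_eq_same, Pi.single_eq_of_ne (inv_ne_one.mpr hδ)] at h1
  exact one_ne_zero h1

variable {V : Type} [AddCommGroup V] [Module ℂ V]

open scoped Classical in
/-- An operator on representations of `SL₂` built from a function on the antidiagonal. -/
noncomputable def intertwiner (ρ : Representation ℂ (SpecialLinearGroup (Fin 2) F) V)
    (ψ : AddChar F ℂ) (δ : F) (h : Fˣ → ℂ) : Module.End ℂ V :=
  ∑ t : Fˣ, h t • (proj ρ ψ 1 * ρ (n t) * proj ρ ψ δ)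

variable {ρ : Representation ℂ (SpecialLinearGroup (Fin 2) F) V} {ψ : AddChar F ℂ} {δ : F}
  {h : Fˣ → ℂ}

theorem intertwiner_mul_proj_zero (hψ : ψ.IsPrimitive) (hδ : δ ≠ 0) :
    intertwiner ρ ψ δ h * proj ρ ψ 0 = 0 := by
  simp only [intertwiner, Finset.sum_mul, smul_mul_assoc]
  refine Finset.sum_eq_zero fun t _ => ?_
  rw [mul_assoc, proj_mul_proj_of_ne ρ hψ hδ, mul_zero, smul_zero]

theorem intertwiner_mul_map_u (x : F) :
    intertwiner ρ ψ δ h * ρ (u x) = ψ (δ * x) • intertwiner ρ ψ δ h := by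
  simp only [intertwiner, Finset.sum_mul, Finset.smul_sum, smul_mul_assoc]
  refine Finset.sum_congr rfl fun t _ => ?_
  rw [mul_assoc, proj_mul_map_u, mul_smul_comm, smul_comm]

theorem map_u_mul_proj_zero (x : F) : ρ (u x) * proj ρ ψ 0 = proj ρ ψ 0 := by
  rw [map_u_mul_proj, zero_mul, AddChar.map_zero_eq_one, one_smul]

theorem map_t_mul_proj_zero (a : Fˣ) : ρ (t a) * proj ρ ψ 0 = proj ρ ψ 0 * ρ (t a) := by
  rw [map_t_mul_proj, zero_mul]

open scoped Classical in
theorem proj_one_mul_map_n_mul_proj_zero (hψ : ψ.IsPrimitive) (t : Fˣ) :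
    proj ρ ψ 1 * ρ (n t) * proj ρ ψ δ * ρ (n 1) * proj ρ ψ 0 = (Fintype.card F : ℂ)⁻¹ •
      ∑ y : Fˣ, ψ (-(δ * (y * (t : F)⁻¹)) + -((t : F) * y)⁻¹) •
        (proj ρ ψ 1 * ρ (n y) * proj ρ ψ 0) := by
  have key : proj ρ ψ 1 * ρ (n t) * proj ρ ψ δ * ρ (n 1) * proj ρ ψ 0 = (Fintype.card F : ℂ)⁻¹ •
      ∑ x, ψ (-(δ * x)) • (proj ρ ψ 1 * ρ (n t * u x * n 1) * proj ρ ψ 0) := by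
    conv_lhs => enter [1, 1, 2]; rw [proj]
    simp only [mul_smul_comm, smul_mul_assoc, Finset.mul_sum, Finset.sum_mul, map_mul, mul_assoc]
  rw [key, sum_eq_add_sum_units, u_zero, mul_one, n_mul_n,
    proj_mul_map_t_mul_proj hψ (by simp), smul_zero, zero_add]
  congr 1
  refine Fintype.sum_equiv (Equiv.mulLeft t) _ _ fun x => ?_
  rw [n_mul_u_mul_n, map_mul, map_mul, ← mul_assoc, ← mul_assoc, proj_mul_map_u, mul_assoc,
    map_u_mul_proj_zero, smul_mul_assoc, smul_mul_assoc, smul_smul, ← AddChar.map_add_eq_mul,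
    mul_one, Equiv.coe_mulLeft, Units.val_mul]
  congr 2
  have := t.ne_zero
  have := x.ne_zero
  field_simp

theorem intertwiner_mul_map_mul_proj_zero (hψ : ψ.IsPrimitive) (hδ : δ ≠ 0)
    (hh : bessel ψ δ h = 0) (g : SpecialLinearGroup (Fin 2) F) :
    intertwiner ρ ψ δ h * ρ g * proj ρ ψ 0 = 0 := by
  classical
  have hn : intertwiner ρ ψ δ h * ρ (n 1) * proj ρ ψ 0 = 0 := by
    simp only [intertwiner, Finset.sum_mul, smul_mul_assoc, proj_one_mul_map_n_mul_proj_zero hψ,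
      smul_comm _ (Fintype.card F : ℂ)⁻¹]
    rw [← Finset.smul_sum]
    simp only [Finset.smul_sum (r := h _), smul_smul]
    rw [Finset.sum_comm]
    refine (congrArg _ (Finset.sum_eq_zero fun y _ => ?_)).trans (smul_zero _)
    rw [← Finset.sum_smul, ← bessel_apply, hh, Pi.zero_apply, zero_smul]
  rcases bruhat g with ⟨a, x, rfl⟩ | ⟨x, c, y, rfl⟩
  · rw [map_mul, mul_assoc, mul_assoc, map_u_mul_proj_zero, map_t_mul_proj_zero, ← mul_assoc,
      intertwiner_mul_proj_zero hψ hδ, zero_mul]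
  · have hc : n c = n 1 * t c := by rw [n_mul_t, one_mul]
    rw [map_mul, map_mul, mul_assoc, mul_assoc, map_u_mul_proj_zero, ← mul_assoc, ← mul_assoc,
      intertwiner_mul_map_u, hc, map_mul ρ, smul_mul_assoc, smul_mul_assoc, ← mul_assoc,
      mul_assoc _ (ρ (t c)), map_t_mul_proj_zero, ← mul_assoc, hn, zero_mul, smul_zero]

theorem exists_irreducible_intertwiner_ne_zero (ψ : AddChar F ℂ) (δ : F) (hh : h ≠ 0) :
    ∃ (V : Type) (_ : AddCommGroup V) (_ : Module ℂ V) (_ : FiniteDimensional ℂ V)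
      (ρ : Representation ℂ (SpecialLinearGroup (Fin 2) F) V), ρ.IsIrreducible ∧
      intertwiner ρ ψ δ h ≠ 0 := by
  classical
  obtain ⟨c, hc⟩ := Function.ne_iff.mp hh
  obtain ⟨V, _, _, _, ρ, hρ, hX⟩ := exists_irreducible_sum_ne_zero
    (fun p : F × Fˣ × F => u p.1 * n p.2.1 * u p.2.2) u_mul_n_mul_u_injective
    (fun p => h p.2.1 * (ψ (-(1 * p.1)) * ψ (-(δ * p.2.2))))
    (fun h' => hc (by simpa using congrFun h' (0, c, 0)))
  refine ⟨V, _, _, inferInstance, ρ, hρ, fun h' => hX ?_⟩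
  have hq : (Fintype.card F : ℂ) ≠ 0 := Nat.cast_ne_zero.mpr Fintype.card_ne_zero
  have key : intertwiner ρ ψ δ h = ((Fintype.card F : ℂ)⁻¹ * (Fintype.card F : ℂ)⁻¹) •
      ∑ p : F × Fˣ × F, (h p.2.1 * (ψ (-(1 * p.1)) * ψ (-(δ * p.2.2)))) •
        ρ (u p.1 * n p.2.1 * u p.2.2) := by
    simp only [intertwiner, proj, Fintype.sum_prod_type, map_mul, Finset.sum_mul, Finset.mul_sum,
      Finset.smul_sum, smul_mul_assoc, mul_smul_comm, smul_smul]
    rw [Finset.sum_comm (s := (Finset.univ : Finset F))]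
    refine Finset.sum_congr rfl fun t _ => ?_
    rw [Finset.sum_comm]
    refine Finset.sum_congr rfl fun x _ => Finset.sum_congr rfl fun y _ => ?_
    congr 1
    ring
  rw [key, smul_eq_zero] at h'
  exact h'.resolve_left (mul_ne_zero (inv_ne_zero hq) (inv_ne_zero hq))

theorem isSquare_div_of_not_isSquare {s δ : F} (hs : ¬IsSquare s)
    (hδ : ¬IsSquare δ) : IsSquare (s / δ) := by
  classical
  have hs0 : s ≠ 0 := fun h => hs (h ▸ IsSquare.zero)
  have hδ0 : δ ≠ 0 := fun h => hδ (h ▸ IsSquare.zero)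
  have h : IsSquare (s * δ) := by
    rw [← quadraticChar_one_iff_isSquare (mul_ne_zero hs0 hδ0), map_mul,
      quadraticChar_neg_one_iff_not_isSquare.mpr hs, quadraticChar_neg_one_iff_not_isSquare.mpr hδ]
    rfl
  rw [show s / δ = s * δ / (δ * δ) by field_simp]
  exact h.div (IsSquare.mul_self δ)

theorem exists_irreducible_finrank_eq_card_sub_one (h2 : ringChar F ≠ 2) :
    ∃ (V : Type) (_ : AddCommGroup V) (_ : Module ℂ V) (_ : FiniteDimensional ℂ V)
      (ρ : Representation ℂ (SpecialLinearGroup (Fin 2) F) V), ρ.IsIrreducible ∧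
      Module.finrank ℂ V = Fintype.card F - 1 := by
  classical
  obtain ⟨ψ, hψ⟩ := exists_isPrimitive F
  obtain ⟨δ, hδ⟩ := FiniteField.exists_nonsquare h2
  have hδ0 : δ ≠ 0 := by
    rintro rfl
    exact hδ (IsSquare.zero)
  obtain ⟨h, hh, hK⟩ := exists_bessel_eq_zero ψ (δ := Units.mk0 δ hδ0) fun h' => hδ (by
    rw [show δ = 1 from congrArg Units.val h']
    exact IsSquare.one)
  obtain ⟨V, _, _, _, ρ, hρ, hX⟩ := exists_irreducible_intertwiner_ne_zero ψ δ hh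
  refine ⟨V, _, _, inferInstance, ρ, hρ, ?_⟩
  have h1 : mult ρ ψ 1 ≠ 0 := by
    rw [mult_ne_zero_iff]
    intro h'
    exact hX (by simp [intertwiner, h'])
  have hδ1 : mult ρ ψ δ ≠ 0 := by
    rw [mult_ne_zero_iff]
    intro h'
    exact hX (by simp [intertwiner, h'])
  have hone : ∀ s ≠ 0, mult ρ ψ s = 1 := by
    intro s hs
    refine le_antisymm (mult_le_one hρ hψ hs) (Nat.one_le_iff_ne_zero.mpr ?_)
    by_cases hsq : IsSquare s
    · obtain ⟨r, rfl⟩ := hsq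
      have := mult_mul_sq (ψ := ψ) ρ 1 (Units.mk0 r (left_ne_zero_of_mul hs))
      rw [Units.val_mk0, one_mul, sq] at this
      rwa [this]
    · obtain ⟨r, hr⟩ := isSquare_div_of_not_isSquare hsq hδ
      rw [div_eq_iff hδ0] at hr
      have hr0 : r ≠ 0 := by
        rintro rfl
        exact hs (by rw [hr, zero_mul, zero_mul])
      have := mult_mul_sq (ψ := ψ) ρ δ (Units.mk0 r hr0)
      rw [Units.val_mk0, sq, mul_comm, ← hr] at this
      rwa [this]
  have hzero : mult ρ ψ 0 = 0 := by
    by_contra h0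
    obtain ⟨v, hv0, hv⟩ := exists_of_mult_ne_zero ρ ψ h0
    apply hX
    ext w
    have hw : w ∈ Submodule.span ℂ (Set.range fun g => ρ g v) := by
      rw [hρ.span_orbit hv0]
      trivial
    have hle : Submodule.span ℂ (Set.range fun g => ρ g v) ≤
        LinearMap.ker (intertwiner ρ ψ δ h) := by
      rw [Submodule.span_le]
      rintro _ ⟨g, rfl⟩
      have := congrArg (fun f : Module.End ℂ V => f v)
        (intertwiner_mul_map_mul_proj_zero (ρ := ρ) hψ hδ0 hK g)
      simp only [Module.End.mul_apply, hv] at this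
      exact this
    exact hle hw
  rw [finrank_of_mult_eq_one hψ hone, hzero, zero_add]

theorem not_isKnutsonType (h2 : ringChar F ≠ 2) (h3 : 3 < Fintype.card F) :
    ¬IsKnutsonType (SpecialLinearGroup (Fin 2) F) := by
  intro hK
  have hodd := FiniteField.odd_card_of_char_ne_two h2
  obtain ⟨V, _, _, _, ρ, hρ, hd⟩ := exists_irreducible_finrank_eq_card_add_one F h3
  obtain ⟨W, _, _, _, σ, hσ, he⟩ := exists_irreducible_finrank_eq_card_sub_one (F := F) h2
  have h4 := four_mul_finrank_dvd_card h2 hK hρ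
  have h5 := four_mul_finrank_dvd_card h2 hK hσ
  rw [hd, card_eq, mul_comm 4] at h4
  rw [he, card_eq, ← mul_assoc] at h5
  replace h4 := Nat.dvd_of_mul_dvd_mul_left (by omega) h4
  replace h5 := Nat.dvd_of_mul_dvd_mul_right (by omega) h5
  obtain ⟨m, hm⟩ := Nat.exists_eq_add_of_lt h3
  generalize Fintype.card F = q at *
  obtain ⟨k, rfl | rfl⟩ : ∃ k, q = 4 * k + 1 ∨ q = 4 * k + 3 := ⟨q / 4, by omega⟩
  · have : (4 * k + 1 + 1) * (4 * k + 1) = 4 * (4 * k * k + 3 * k) + 2 := by ring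
    omega
  · have : (4 * k + 3) * (4 * k + 3 - 1) = 4 * (4 * k * k + 5 * k + 1) + 2 := by
      rw [Nat.add_sub_assoc (by norm_num)]
      ring
    omega

end SL2

/-- Savitskii's criterion for `SL₂(𝔽_q)`: for a prime power `q`,
`ℂ[SL₂(𝔽_q)]` is of Knutson type if and only if `q` is a power of `2` or `q = 3`. -/
theorem sl2_isKnutsonType_iff (q : ℕ) (hq : IsPrimePow q)
    (F : Type) [Field F] [Fintype F] (hF : Fintype.card F = q) :
    IsKnutsonType (Matrix.SpecialLinearGroup (Fin 2) F) ↔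
      (∃ m : ℕ, q = 2 ^ m) ∨ q = 3 := by
  constructor
  · intro hK
    by_contra! h
    have h2 : ringChar F ≠ 2 := by
      intro h2
      obtain ⟨n, -, hn⟩ := FiniteField.card F (ringChar F)
      exact h.1 n (by rw [← hF, hn, h2])
    have hodd := FiniteField.odd_card_of_char_ne_two h2
    have h1 := Fintype.one_lt_card (α := F)
    exact SL2.not_isKnutsonType h2 (by have := h.2; omega) hK
  · rintro (⟨m, hm⟩ | h)
    · obtain ⟨n, hp, hn⟩ := FiniteField.card F (ringChar F)
      have hdvd : ringChar F ∣ 2 ^ m := by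
        rw [← hm, ← hF, hn]
        exact dvd_pow_self _ n.ne_zero
      have := ringChar.of_eq ((Nat.prime_dvd_prime_iff_eq hp Nat.prime_two).mp
        (hp.dvd_of_dvd_pow hdvd))
      exact SL2.isKnutsonType_of_charP_two F
    · exact SL2.isKnutsonType_of_card_eq_three (hF.trans h)
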